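/- arXiv:1601.06928 — 4 statements merged into one kernel-verified Lean document; each statement's English description precedes it below -/
import Mathlib

section
/- Let K be an algebraically closed field and R = K[x_1,...,x_n] the polynomial ring with its standard grading (n ≥ 2). Suppose f_1,...,f_n is a homogeneous regular sequence in R in which at least n−2 of the f_j are products of linear forms and the remaining two are arbitrary homogeneous polynomials of positive degree. Then the graded Artinian complete intersection A = R/(f_1,...,f_n) has the Sperner property: the maximum of μ(I) over all ideals I of A equals max_i dim_K A_i. -/
open MvPolynomial Module

/-- The degree-`i` homogeneous component of the standard graded quotient `R/b` of the
polynomial ring `R = K[x_1,…,x_n]` by an ideal `b`: the image of the space of homogeneous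
polynomials of degree `i`.  Its dimension is the value `H(R/b, i)` of the Hilbert function. -/
noncomputable def gradedPiece {K : Type*} [Field K] {n : ℕ}
    (b : Ideal (MvPolynomial (Fin n) K)) (i : ℕ) :
    Submodule K (MvPolynomial (Fin n) K ⧸ b) :=
  (homogeneousSubmodule (Fin n) K i).map (Ideal.Quotient.mkₐ K b).toLinearMap

/-- `μ(I) = dim_K I/mI`, the minimal number of generators of an ideal `I` of a graded algebra
`A` over `K` with graded maximal ideal `m`. -/
noncomputable def nu (K : Type*) {A : Type*} [Field K] [CommRing A] [Algebra K A]
    (m I : Ideal A) : ℕ :=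
  finrank K
    (↥(I.restrictScalars K) ⧸
      (Submodule.comap (I.restrictScalars K).subtype ((m * I).restrictScalars K)))

/-- The graded maximal ideal `m = ⊕_{i ≥ 1} A_i` of the graded quotient `A = R/b`. -/
noncomputable def gradedMaxIdeal {K : Type*} [Field K] {n : ℕ}
    (b : Ideal (MvPolynomial (Fin n) K)) : Ideal (MvPolynomial (Fin n) K ⧸ b) :=
  Ideal.span {x | ∃ i ≥ 1, x ∈ gradedPiece b i}

/-- A polynomial is a (nonempty, finite) product of linear forms, i.e. of homogeneous
polynomials of degree `1`. -/
def IsProductOfLinearForms {K : Type*} [Field K] {n : ℕ} (L : MvPolynomial (Fin n) K) : Prop :=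
  ∃ k : ℕ, 0 < k ∧ ∃ g : Fin k → MvPolynomial (Fin n) K,
    (∀ t, (g t).IsHomogeneous 1) ∧ L = ∏ t, g t

/-- A real sequence is strongly log-concave (no internal zeros are allowed when it is
nonnegative). -/
def StronglyLogConcave (h : ℤ → ℝ) : Prop :=
  ∀ x y, x ≤ y → h x * h (y + 1) ≤ h (x + 1) * h y

/-- The convolution of `h` with the indicator function of `{0, …, a - 1}`. -/
noncomputable def windowSum (a : ℕ) (h : ℤ → ℝ) (d : ℤ) : ℝ := ∑ i ∈ Finset.range a, h (d - i)

lemma StronglyLogConcave.mul_le_mul_of_add_le {h : ℤ → ℝ} (hh : StronglyLogConcave h) (k : ℕ) :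
    ∀ x y : ℤ, x + k ≤ y → h x * h (y + k) ≤ h (x + k) * h y := by
  induction k with
  | zero => intro x y _; simp
  | succ k ih =>
    intro x y hxy
    push_cast at hxy ⊢
    have h1 := hh x (y + k) (by omega)
    have h2 := ih (x + 1) y (by omega)
    rw [show x + 1 + (k : ℤ) = x + (k + 1) by ring] at h2
    rw [show y + (k : ℤ) + 1 = y + (k + 1) by ring] at h1
    exact h1.trans h2

lemma StronglyLogConcave.mul_le_mul {h : ℤ → ℝ} (hh : StronglyLogConcave h) {a b c d : ℤ}
    (hab : a + b = c + d) (hac : a ≤ c) (had : a ≤ d) : h a * h b ≤ h c * h d := by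
  wlog hcd : c ≤ d generalizing c d
  · rw [mul_comm (h c)]
    exact this (by omega) had hac (by omega)
  obtain ⟨k, rfl⟩ : ∃ k : ℕ, c = a + k := ⟨(c - a).toNat, by omega⟩
  obtain rfl : b = d + k := by omega
  exact hh.mul_le_mul_of_add_le k a d hcd

lemma windowSum_nonneg {h : ℤ → ℝ} (h0 : ∀ d, 0 ≤ h d) (a : ℕ) (d : ℤ) : 0 ≤ windowSum a h d :=
  Finset.sum_nonneg fun _ _ => h0 _

lemma windowSum_succ (a : ℕ) (h : ℤ → ℝ) (d : ℤ) :
    windowSum (a + 1) h d = windowSum a h d + h (d - a) := Finset.sum_range_succ _ _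

lemma windowSum_succ' (a : ℕ) (h : ℤ → ℝ) (d : ℤ) :
    windowSum (a + 1) h (d + 1) = h (d + 1) + windowSum a h d := by
  unfold windowSum
  rw [Finset.sum_range_succ', add_comm]
  congr 1
  · simp
  · exact Finset.sum_congr rfl fun i _ => by congr 1; push_cast; ring

lemma StronglyLogConcave.windowSum {h : ℤ → ℝ} (hh : StronglyLogConcave h) (a : ℕ) :
    StronglyLogConcave (windowSum a h) := by
  intro x y hxy
  have key : ∀ z, _root_.windowSum a h (z + 1) =
      _root_.windowSum a h z + h (z + 1) - h (z + 1 - a) := by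
    intro z
    have := windowSum_succ' a h z
    rw [windowSum_succ] at this
    linarith
  rw [key x, key y]
  have h1 : _root_.windowSum a h x * h (y + 1) ≤ _root_.windowSum a h y * h (x + 1) := by
    unfold _root_.windowSum
    rw [Finset.sum_mul, Finset.sum_mul]
    refine Finset.sum_le_sum fun i hi => ?_
    exact hh.mul_le_mul (by ring) (by omega) (by omega)
  have h2 : _root_.windowSum a h y * h (x + 1 - a) ≤ _root_.windowSum a h x * h (y + 1 - a) := by
    unfold _root_.windowSum
    rw [Finset.sum_mul, Finset.sum_mul]
    refine Finset.sum_le_sum fun i hi => ?_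
    have := Finset.mem_range.1 hi
    rw [mul_comm]
    exact hh.mul_le_mul (by ring) (by omega) (by omega)
  linarith

lemma StronglyLogConcave.eq_zero_succ {h : ℤ → ℝ} (hh : StronglyLogConcave h)
    (h0 : ∀ d, 0 ≤ h d) (hpos : 0 < h 0) {d : ℤ} (hd : 0 ≤ d) (hz : h d = 0) :
    h (d + 1) = 0 := by
  have := hh 0 d hd
  rw [hz, mul_zero] at this
  nlinarith [h0 (d + 1)]

/-- The numerical heart of the product theorem for normalized matching: if `ρ (i + 1)` is the
relative size of the `i`-th layer, pushing each layer both up and to its successor yields a set of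
at least the expected relative size. -/
lemma normalized_matching_windowSum {h : ℤ → ℝ} (h0 : ∀ d, 0 ≤ h d) (hh : StronglyLogConcave h)
    (a : ℕ) (d : ℤ) (ρ : ℕ → ℝ) :
    (∑ i ∈ Finset.range a, ρ (i + 1) * h (d - i)) * windowSum a h (d + 1) ≤
      (∑ i ∈ Finset.range a, h (d + 1 - i) * max (ρ (i + 1)) (ρ i)) * windowSum a h d := by
  set T : ℕ → ℝ := fun i =>
    windowSum a h (d + 1) * windowSum i h d - windowSum a h d * windowSum i h (d + 1) with hT
  have hT0 : T 0 = 0 := by simp [hT, windowSum]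
  have hTa : T a = 0 := by simp only [hT]; ring
  have hTs : ∀ i, T (i + 1) =
      T i + windowSum a h (d + 1) * h (d - i) - windowSum a h d * h (d + 1 - i) := by
    intro i
    simp only [hT, windowSum_succ]
    ring
  have hTnn : ∀ i ≤ a, 0 ≤ T i := by
    intro i hi
    simp only [hT]
    have : ∀ k, i ≤ k → windowSum k h d * windowSum i h (d + 1) ≤
        windowSum k h (d + 1) * windowSum i h d := by
      intro k hk
      induction k, hk using Nat.le_induction with
      | base => rw [mul_comm]
      | succ k hk ih =>
        rw [windowSum_succ, windowSum_succ]
        have : h (d - k) * windowSum i h (d + 1) ≤ h (d + 1 - k) * windowSum i h d := by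
          unfold windowSum
          rw [Finset.mul_sum, Finset.mul_sum]
          refine Finset.sum_le_sum fun j hj => ?_
          have := Finset.mem_range.1 hj
          exact hh.mul_le_mul (by ring) (by omega) (by omega)
        linarith
    linarith [this a hi]
  have hTle : ∀ i < a, T i ≤ windowSum a h d * h (d + 1 - i) := by
    intro i hi
    obtain ⟨b, rfl⟩ : ∃ b, a = b + 1 := ⟨a - 1, by omega⟩
    have e1 := windowSum_succ' i h d
    have e2 := windowSum_succ i h (d + 1)
    have e3 := windowSum_succ' b h d
    have e4 := windowSum_succ b h d
    have p1 := windowSum_nonneg h0 i d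
    have p2 := windowSum_nonneg h0 (b + 1) d
    have p3 := windowSum_nonneg h0 (b + 1) (d + 1)
    have p4 := h0 (d - b)
    have p5 := h0 (d + 1)
    have hle : windowSum (i + 1) h (d + 1) ≤ windowSum (b + 1) h (d + 1) :=
      Finset.sum_le_sum_of_subset_of_nonneg (Finset.range_mono (by omega)) fun _ _ _ => h0 _
    suffices windowSum (b + 1) h (d + 1) * windowSum i h d ≤
        windowSum (b + 1) h d * windowSum (i + 1) h (d + 1) by
      rw [e2] at this
      simp only [hT]
      linarith
    rcases le_total (windowSum (b + 1) h (d + 1)) (windowSum (b + 1) h d) with hc | hc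
    · calc _ ≤ windowSum (b + 1) h d * windowSum i h d := by gcongr
        _ ≤ _ := by gcongr; linarith
    · nlinarith [mul_nonneg (sub_nonneg.2 hc) (sub_nonneg.2 hle)]
  have hterm : ∀ i ∈ Finset.range a,
      windowSum a h (d + 1) * (ρ (i + 1) * h (d - i)) + (T i * ρ i - T (i + 1) * ρ (i + 1)) ≤
        h (d + 1 - i) * max (ρ (i + 1)) (ρ i) * windowSum a h d := by
    intro i hi
    have hi := Finset.mem_range.1 hi
    rw [hTs]
    have m1 := mul_le_mul_of_nonneg_left (le_max_left (ρ (i + 1)) (ρ i))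
      (sub_nonneg.2 (hTle i hi))
    have m2 := mul_le_mul_of_nonneg_left (le_max_right (ρ (i + 1)) (ρ i)) (hTnn i hi.le)
    nlinarith
  have hsum := Finset.sum_le_sum hterm
  rw [Finset.sum_add_distrib, Finset.sum_range_sub' (fun i => T i * ρ i), hT0, hTa,
    ← Finset.mul_sum, ← Finset.sum_mul] at hsum
  linarith

section QuotDim

variable {K R : Type*} [Field K] [CommRing R] [Algebra K R]

lemma finrank_map_add_finrank_inf_ker {M N : Type*} [AddCommGroup M] [Module K M]
    [AddCommGroup N] [Module K N] (φ : M →ₗ[K] N) (V : Submodule K M) [FiniteDimensional K V] :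
    finrank K (V.map φ) + finrank K (V ⊓ LinearMap.ker φ : Submodule K M) = finrank K V := by
  have h := LinearMap.finrank_range_add_finrank_ker (φ.domRestrict V)
  rw [LinearMap.range_domRestrict] at h
  rw [← h, LinearMap.ker_domRestrict]
  congr 1
  rw [← Submodule.map_comap_subtype]
  exact (LinearEquiv.finrank_eq
    (Submodule.equivMapOfInjective V.subtype V.injective_subtype _)).symm

/-- The dimension of the image of a `K`-subspace `V` of `R` in the quotient `R ⧸ J`. -/
noncomputable def quotDim (J : Ideal R) (V : Submodule K R) : ℕ :=
  finrank K (V.map (Ideal.Quotient.mkₐ K J).toLinearMap)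

lemma ker_mkₐ_toLinearMap (J : Ideal R) :
    LinearMap.ker (Ideal.Quotient.mkₐ K J).toLinearMap = J.restrictScalars K := by
  ext x
  simp [Ideal.Quotient.eq_zero_iff_mem]

lemma quotDim_add_finrank_inf (J : Ideal R) (V : Submodule K R) [FiniteDimensional K V] :
    quotDim J V + finrank K (V ⊓ J.restrictScalars K : Submodule K R) = finrank K V := by
  rw [← ker_mkₐ_toLinearMap]
  exact finrank_map_add_finrank_inf_ker _ V

lemma quotDim_mono (J : Ideal R) {V W : Submodule K R} [FiniteDimensional K W] (h : V ≤ W) :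
    quotDim J V ≤ quotDim J W :=
  Submodule.finrank_mono (Submodule.map_mono h)

lemma map_mkₐ_sup_of_le (J : Ideal R) (V : Submodule K R) {Z : Submodule K R}
    (hZ : Z ≤ J.restrictScalars K) :
    (V ⊔ Z).map (Ideal.Quotient.mkₐ K J).toLinearMap =
      V.map (Ideal.Quotient.mkₐ K J).toLinearMap := by
  have h : Z.map (Ideal.Quotient.mkₐ K J).toLinearMap = ⊥ :=
    LinearMap.le_ker_iff_map.1 (hZ.trans (ker_mkₐ_toLinearMap J).ge)
  rw [Submodule.map_sup, h, sup_bot_eq]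

lemma quotDim_top (V : Submodule K R) [FiniteDimensional K V] : quotDim (⊤ : Ideal R) V = 0 := by
  have := quotDim_add_finrank_inf (⊤ : Ideal R) V
  rw [Submodule.restrictScalars_top, inf_top_eq] at this
  omega

variable (𝒜 : ℤ → Submodule K R)

/-- Normalized matching for the standard graded algebra `R ⧸ J`: multiplying a subspace of a graded
piece by all linear forms does not decrease its relative dimension. -/
def HasNormalizedMatching (J : Ideal R) : Prop :=
  ∀ (d : ℤ) (V : Submodule K R), V ≤ 𝒜 d →
    quotDim J V * quotDim J (𝒜 (d + 1)) ≤ quotDim J (𝒜 1 * V) * quotDim J (𝒜 d)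

/-- The degree `d` piece of the colon of `V` by `ℓ`. -/
def colonPiece (d : ℤ) (ℓ : R) (V : Submodule K R) : Submodule K R :=
  𝒜 d ⊓ V.comap (LinearMap.mulLeft K ℓ)

variable [GradedAlgebra 𝒜]

lemma mem_sup_span_singleton_of_mul_mem {J : Ideal R} {ℓ u x : R}
    (hreg : ∀ x, ℓ * x ∈ J → x ∈ J) (hx : ℓ * x ∈ J ⊔ Ideal.span {ℓ * u}) :
    x ∈ J ⊔ Ideal.span {u} := by
  obtain ⟨j, hj, y, hy, hjy⟩ := Submodule.mem_sup.1 hx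
  obtain ⟨z, rfl⟩ := Ideal.mem_span_singleton'.1 hy
  have : x - z * u ∈ J := hreg _ (by
    rw [show ℓ * (x - z * u) = j by linear_combination -hjy]; exact hj)
  rw [show x = (x - z * u) + z * u by ring]
  exact Submodule.add_mem_sup this (Ideal.mul_mem_left _ _ (Ideal.mem_span_singleton_self u))

lemma mul_mem_sup_span_singleton {J : Ideal R} {ℓ u x : R}
    (hx : x ∈ J ⊔ Ideal.span {u}) : ℓ * x ∈ J ⊔ Ideal.span {ℓ * u} := by
  obtain ⟨j, hj, y, hy, rfl⟩ := Submodule.mem_sup.1 hx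
  obtain ⟨z, rfl⟩ := Ideal.mem_span_singleton'.1 hy
  rw [show ℓ * (j + z * u) = ℓ * j + z * (ℓ * u) by ring]
  exact Submodule.add_mem_sup (Ideal.mul_mem_left _ _ hj)
    (Ideal.mul_mem_left _ _ (Ideal.mem_span_singleton_self _))

lemma exists_add_mul_of_mem_sup_span_singleton {J : Ideal R} (hJ : J.IsHomogeneous 𝒜) {ℓ : R}
    (hℓ : ℓ ∈ 𝒜 1) {d : ℤ} {v : R} (hv : v ∈ 𝒜 d) (hvJ : v ∈ J ⊔ Ideal.span {ℓ}) :
    ∃ j ∈ J, ∃ x ∈ 𝒜 (d - 1), j ∈ 𝒜 d ∧ v = j + ℓ * x := by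
  obtain ⟨j, hj, y, hy, rfl⟩ := Submodule.mem_sup.1 hvJ
  obtain ⟨z, rfl⟩ := Ideal.mem_span_singleton'.1 hy
  refine ⟨DirectSum.decompose 𝒜 j d, hJ d hj, DirectSum.decompose 𝒜 z (d - 1),
    SetLike.coe_mem _, SetLike.coe_mem _, ?_⟩
  have h1 := DirectSum.coe_decompose_mul_add_of_left_mem 𝒜 (j := d - 1) (b := z) hℓ
  rw [show (1 : ℤ) + (d - 1) = d by ring] at h1
  rw [← h1, mul_comm ℓ z]
  conv_lhs => rw [← DirectSum.decompose_of_mem_same 𝒜 hv]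
  rw [DirectSum.decompose_add, DirectSum.add_apply, Submodule.coe_add]

variable [∀ d, FiniteDimensional K (𝒜 d)]

lemma quotDim_eq_add_colonPiece {J : Ideal R} (hJ : J.IsHomogeneous 𝒜) {ℓ u : R} (hℓ : ℓ ∈ 𝒜 1)
    (hreg : ∀ x, ℓ * x ∈ J → x ∈ J) {d : ℤ} {V : Submodule K R} (hV : V ≤ 𝒜 d)
    (hJV : ∀ x ∈ 𝒜 d, x ∈ J ⊔ Ideal.span {ℓ * u} → x ∈ V) :
    quotDim (J ⊔ Ideal.span {ℓ * u}) V =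
      quotDim (J ⊔ Ideal.span {ℓ}) V + quotDim (J ⊔ Ideal.span {u}) (colonPiece 𝒜 (d - 1) ℓ V) := by
  set J₀ := J ⊔ Ideal.span {ℓ * u}
  set J₁ := J ⊔ Ideal.span {ℓ}
  set J₂ := J ⊔ Ideal.span {u}
  set C := colonPiece 𝒜 (d - 1) ℓ V
  have : FiniteDimensional K V := Submodule.finiteDimensional_of_le hV
  have : FiniteDimensional K C :=
    Submodule.finiteDimensional_of_le (inf_le_left : C ≤ 𝒜 (d - 1))
  have hJ01 : J₀ ≤ J₁ := by
    refine sup_le le_sup_left ?_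
    rw [Ideal.span_singleton_le_iff_mem]
    exact Ideal.mul_mem_right _ _ (Submodule.mem_sup_right (Ideal.mem_span_singleton_self ℓ))
  set V₁ : Submodule K R := V ⊓ J₁.restrictScalars K
  have : FiniteDimensional K V₁ := Submodule.finiteDimensional_of_le (inf_le_left : V₁ ≤ V)
  have e0 := quotDim_add_finrank_inf J₀ V
  have e1 : quotDim J₁ V + finrank K V₁ = finrank K V := quotDim_add_finrank_inf J₁ V
  have e2 := quotDim_add_finrank_inf J₀ V₁
  have e3 : V₁ ⊓ J₀.restrictScalars K = V ⊓ J₀.restrictScalars K := by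
    rw [inf_assoc, inf_eq_right.2 (show J₀.restrictScalars K ≤ J₁.restrictScalars K from hJ01)]
  rw [e3] at e2
  set ψ : R →ₗ[K] R ⧸ J₀ := (Ideal.Quotient.mkₐ K J₀).toLinearMap ∘ₗ LinearMap.mulLeft K ℓ
  have e4 := finrank_map_add_finrank_inf_ker ψ C
  have e5 := quotDim_add_finrank_inf J₂ C
  have hker : LinearMap.ker ψ = J₂.restrictScalars K := by
    ext x
    simp only [ψ, LinearMap.mem_ker, LinearMap.comp_apply, LinearMap.mulLeft_apply,
      AlgHom.toLinearMap_apply, Ideal.Quotient.mkₐ_eq_mk, Ideal.Quotient.eq_zero_iff_mem,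
      Submodule.restrictScalars_mem]
    exact ⟨mem_sup_span_singleton_of_mul_mem hreg, mul_mem_sup_span_singleton⟩
  have hmap : C.map ψ = V₁.map (Ideal.Quotient.mkₐ K J₀).toLinearMap := by
    apply le_antisymm
    · rintro _ ⟨x, hx, rfl⟩
      exact ⟨ℓ * x, ⟨hx.2, Ideal.mul_mem_right _ _
        (Submodule.mem_sup_right (Ideal.mem_span_singleton_self ℓ))⟩, rfl⟩
    · rintro _ ⟨v, ⟨hvV, hvJ⟩, rfl⟩
      obtain ⟨j, hj, x, hx, hjd, rfl⟩ :=
        exists_add_mul_of_mem_sup_span_singleton 𝒜 hJ hℓ (hV hvV) hvJ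
      have hj0 : j ∈ J₀ := Submodule.mem_sup_left hj
      refine ⟨x, ⟨hx, ?_⟩, ?_⟩
      · have := V.sub_mem hvV (hJV j hjd hj0)
        simpa using this
      · simp [ψ, Ideal.Quotient.eq_zero_iff_mem.2 hj0]
  rw [hker, hmap] at e4
  change quotDim J₀ V₁ + _ = _ at e4
  omega

lemma quotDim_piece_eq_windowSum {J : Ideal R} (hJ : J.IsHomogeneous 𝒜) (h : ℤ → ℝ)
    (s : Multiset R) (hs : ∀ ℓ ∈ s, ℓ ∈ 𝒜 1 ∧ (∀ x, ℓ * x ∈ J → x ∈ J) ∧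
      ∀ e, (quotDim (J ⊔ Ideal.span {ℓ}) (𝒜 e) : ℝ) = h e) (d : ℤ) :
    (quotDim (J ⊔ Ideal.span {s.prod}) (𝒜 d) : ℝ) = windowSum s.card h d := by
  induction s using Multiset.induction_on generalizing d with
  | empty => simp [quotDim_top, windowSum, Ideal.span_singleton_one]
  | cons ℓ s ih =>
    obtain ⟨h1, h2, h3⟩ := hs ℓ (Multiset.mem_cons_self ℓ s)
    rw [Multiset.prod_cons, quotDim_eq_add_colonPiece 𝒜 hJ h1 h2 le_rfl (fun x hx _ => hx)]
    have hc : colonPiece 𝒜 (d - 1) ℓ (𝒜 d) = 𝒜 (d - 1) := by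
      refine inf_eq_left.2 fun x hx => ?_
      have := SetLike.mul_mem_graded h1 hx
      rwa [show (1 : ℤ) + (d - 1) = d by ring] at this
    have := windowSum_succ' s.card h (d - 1)
    rw [sub_add_cancel] at this
    rw [hc, Multiset.card_cons, this, Nat.cast_add, h3,
      ih (fun l hl => hs l (Multiset.mem_cons_of_mem hl))]

lemma exists_layers {J : Ideal R} (hJ : J.IsHomogeneous 𝒜) {h : ℤ → ℝ} (n : ℕ) :
    ∀ (s : Multiset R) (_ : s.card = n) (_ : ∀ ℓ ∈ s, ℓ ∈ 𝒜 1 ∧ (∀ x, ℓ * x ∈ J → x ∈ J) ∧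
      (∀ e, (quotDim (J ⊔ Ideal.span {ℓ}) (𝒜 e) : ℝ) = h e) ∧
      HasNormalizedMatching 𝒜 (J ⊔ Ideal.span {ℓ}))
    (d : ℤ) (V W : Submodule K R) (p : ℝ) (_ : V ≤ 𝒜 d) (_ : W ≤ 𝒜 (d + 1)) (_ : 𝒜 1 * V ≤ W)
    (_ : ∀ x ∈ 𝒜 d, x ∈ J ⊔ Ideal.span {s.prod} → x ∈ V)
    (_ : ∀ x ∈ 𝒜 (d + 1), x ∈ J ⊔ Ideal.span {s.prod} → x ∈ W)
    (_ : ∀ ℓ ∈ s, p * h (d + 1) ≤ quotDim (J ⊔ Ideal.span {ℓ}) W),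
    ∃ ρ : ℕ → ℝ, ρ 0 = p ∧
      (quotDim (J ⊔ Ideal.span {s.prod}) V : ℝ) = ∑ i ∈ Finset.range n, ρ (i + 1) * h (d - i) ∧
      ∑ i ∈ Finset.range n, h (d + 1 - i) * max (ρ (i + 1)) (ρ i) ≤
        quotDim (J ⊔ Ideal.span {s.prod}) W := by
  induction n with
  | zero =>
    intro s hcard hs d V W p hV hW hVW hJV hJW hp
    have : FiniteDimensional K V := Submodule.finiteDimensional_of_le hV
    obtain rfl := Multiset.card_eq_zero.1 hcard
    exact ⟨fun _ => p, rfl, by simp [quotDim_top, Ideal.span_singleton_one], by simp⟩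
  | succ n ih =>
    intro s hcard hs d V W p hV hW hVW hJV hJW hp
    have : FiniteDimensional K V := Submodule.finiteDimensional_of_le hV
    have : FiniteDimensional K W := Submodule.finiteDimensional_of_le hW
    obtain ⟨ℓ, hℓs, hmin⟩ : ∃ ℓ ∈ s, ∀ l ∈ s,
        quotDim (J ⊔ Ideal.span {ℓ}) V ≤ quotDim (J ⊔ Ideal.span {l}) V := by
      classical
      obtain ⟨ℓ, h1, h2⟩ := s.toFinset.exists_min_image
        (fun l => quotDim (J ⊔ Ideal.span {l}) V)
        (by
          obtain ⟨a, ha⟩ := Multiset.card_pos_iff_exists_mem.1 (by omega : 0 < s.card)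
          exact ⟨a, Multiset.mem_toFinset.2 ha⟩)
      exact ⟨ℓ, Multiset.mem_toFinset.1 h1, fun l hl => h2 l (Multiset.mem_toFinset.2 hl)⟩
    obtain ⟨t, rfl⟩ := Multiset.exists_cons_of_mem hℓs
    obtain ⟨hℓ1, hreg, hh, hNM⟩ := hs ℓ hℓs
    rw [Multiset.card_cons, Nat.add_right_cancel_iff] at hcard
    rw [Multiset.prod_cons] at hJV hJW ⊢
    set q : ℝ := quotDim (J ⊔ Ideal.span {ℓ}) V / h d with hq
    have hVd := quotDim_mono (J ⊔ Ideal.span {ℓ}) hV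
    have hhn : ∀ e, 0 ≤ h e := fun e => by rw [← hh]; positivity
    have hqV : (quotDim (J ⊔ Ideal.span {ℓ}) V : ℝ) = q * h d := by
      rcases eq_or_ne (h d) 0 with h0 | h0
      · have : (quotDim (J ⊔ Ideal.span {ℓ}) V : ℝ) ≤ 0 := by
          rw [← h0, ← hh]; exact_mod_cast hVd
        rw [h0, mul_zero]
        exact le_antisymm this (Nat.cast_nonneg _)
      · rw [hq, div_mul_cancel₀ _ h0]
    have hqW : q * h (d + 1) ≤ quotDim (J ⊔ Ideal.span {ℓ}) W := by
      rcases (hhn d).eq_or_lt with h0 | h0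
      · rw [hq, ← h0, div_zero, zero_mul]; positivity
      · rw [hq, div_mul_eq_mul_div, div_le_iff₀ h0, ← hh, ← hh]
        have h1 := hNM d V hV
        have h2 := quotDim_mono (J ⊔ Ideal.span {ℓ}) hVW
        exact_mod_cast h1.trans (Nat.mul_le_mul_right _ h2)
    have hVC : V ≤ colonPiece 𝒜 d ℓ W := fun x hx =>
      ⟨hV hx, hVW (Submodule.mul_mem_mul hℓ1 hx)⟩
    have : FiniteDimensional K (colonPiece 𝒜 d ℓ W) :=
      Submodule.finiteDimensional_of_le (inf_le_left : _ ≤ 𝒜 d)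
    have hcol : ∀ (e : ℤ) (U : Submodule K R),
        (∀ x ∈ 𝒜 e, x ∈ J ⊔ Ideal.span {ℓ * t.prod} → x ∈ U) →
        ∀ x ∈ 𝒜 (e - 1), x ∈ J ⊔ Ideal.span {t.prod} → x ∈ colonPiece 𝒜 (e - 1) ℓ U := by
      intro e U hU x hx hxJ
      refine ⟨hx, hU _ ?_ (mul_mem_sup_span_singleton hxJ)⟩
      have := SetLike.mul_mem_graded hℓ1 hx
      rwa [show (1 : ℤ) + (e - 1) = e by ring] at this
    have hcolW := hcol (d + 1) W hJW
    rw [add_sub_cancel_right] at hcolW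
    obtain ⟨ρ, hρ0, hρV, hρW⟩ := ih t hcard (fun l hl => hs l (Multiset.mem_cons_of_mem hl)) (d - 1)
      (colonPiece 𝒜 (d - 1) ℓ V) (colonPiece 𝒜 d ℓ W) q inf_le_left
      (by rw [sub_add_cancel]; exact inf_le_left)
      (by
        rw [Submodule.mul_le]
        intro a ha x hx
        refine ⟨?_, ?_⟩
        · have := SetLike.mul_mem_graded ha hx.1
          rwa [show (1 : ℤ) + (d - 1) = d by ring] at this
        · have := hVW (Submodule.mul_mem_mul ha hx.2)
          simpa [mul_left_comm] using this)
      (hcol d V hJV) (by rw [sub_add_cancel]; exact hcolW)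
      (by
        intro l hl
        have hls : l ∈ ℓ ::ₘ t := Multiset.mem_cons_of_mem hl
        rw [sub_add_cancel, ← hqV]
        exact_mod_cast (hmin l hls).trans (quotDim_mono _ hVC))
    refine ⟨fun i => Nat.casesOn i p ρ, rfl, ?_, ?_⟩
    · rw [quotDim_eq_add_colonPiece 𝒜 hJ hℓ1 hreg hV hJV, Nat.cast_add, hρV, hqV,
        Finset.sum_range_succ', add_comm]
      simp only [hρ0]
      congr 1
      · exact Finset.sum_congr rfl fun i _ => by congr 2; push_cast; ring
      · simp
    · rw [quotDim_eq_add_colonPiece 𝒜 hJ hℓ1 hreg hW hJW, Nat.cast_add, Finset.sum_range_succ',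
        add_comm, add_sub_cancel_right]
      simp only [hρ0]
      refine add_le_add ?_ (le_trans (le_of_eq ?_) hρW)
      · rw [Nat.cast_zero, sub_zero, mul_max_of_nonneg _ _ (hhn _)]
        refine max_le ?_ ?_
        · linarith
        · have := hp ℓ hℓs
          rw [mul_comm] at this
          exact this
      · exact Finset.sum_congr rfl fun i _ => by congr 2; push_cast; ring

lemma HasNormalizedMatching.sup_span_prod {J : Ideal R} (hJ : J.IsHomogeneous 𝒜) {h : ℤ → ℝ}
    (hlc : StronglyLogConcave h) (s : Multiset R)
    (hs : ∀ ℓ ∈ s, ℓ ∈ 𝒜 1 ∧ (∀ x, ℓ * x ∈ J → x ∈ J) ∧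
      (∀ e, (quotDim (J ⊔ Ideal.span {ℓ}) (𝒜 e) : ℝ) = h e) ∧
      HasNormalizedMatching 𝒜 (J ⊔ Ideal.span {ℓ})) (hs0 : s ≠ 0) :
    HasNormalizedMatching 𝒜 (J ⊔ Ideal.span {s.prod}) := by
  intro d V hV
  set I := J ⊔ Ideal.span {s.prod} with hI
  have hh0 : ∀ e, 0 ≤ h e := by
    obtain ⟨ℓ, hℓ⟩ := Multiset.exists_mem_of_ne_zero hs0
    intro e
    rw [← (hs ℓ hℓ).2.2.1]
    positivity
  have hHF := quotDim_piece_eq_windowSum 𝒜 hJ h s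
    (fun ℓ hℓ => ⟨(hs ℓ hℓ).1, (hs ℓ hℓ).2.1, (hs ℓ hℓ).2.2.1⟩)
  set Z : ℤ → Submodule K R := fun e => 𝒜 e ⊓ I.restrictScalars K with hZ
  have hmulA : 𝒜 1 * V ≤ 𝒜 (d + 1) := by
    rw [Submodule.mul_le]
    intro a ha x hx
    have := SetLike.mul_mem_graded ha (hV hx)
    rwa [add_comm] at this
  obtain ⟨ρ, hρ0, hρV, hρW⟩ := exists_layers 𝒜 hJ (h := h) s.card s rfl hs d (V ⊔ Z d)
    (𝒜 1 * V ⊔ Z (d + 1)) 0 (sup_le hV inf_le_left) (sup_le hmulA inf_le_left)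
    (by
      rw [Submodule.mul_sup]
      refine sup_le_sup_left ?_ _
      rw [Submodule.mul_le]
      intro a ha x hx
      refine ⟨?_, (I.mul_mem_left a hx.2 : a * x ∈ I)⟩
      have := SetLike.mul_mem_graded ha hx.1
      rwa [add_comm] at this)
    (fun x hx hxI => Submodule.mem_sup_right ⟨hx, hxI⟩)
    (fun x hx hxI => Submodule.mem_sup_right ⟨hx, hxI⟩)
    (fun ℓ _ => by rw [zero_mul]; positivity)
  unfold quotDim at hρV hρW
  rw [map_mkₐ_sup_of_le _ _ inf_le_right] at hρV hρW
  have key := normalized_matching_windowSum hh0 hlc s.card d ρ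
  rw [← hρV, ← hHF, ← hHF] at key
  have : (quotDim I V : ℝ) * quotDim I (𝒜 (d + 1)) ≤
      quotDim I (𝒜 1 * V) * quotDim I (𝒜 d) :=
    key.trans (mul_le_mul_of_nonneg_right hρW (Nat.cast_nonneg _))
  exact_mod_cast this

end QuotDim

section IntGrading

variable (K : Type*) [Field K] (n : ℕ)

/-- The standard grading of the polynomial ring, indexed by the integers. -/
noncomputable def intPiece (d : ℤ) : Submodule K (MvPolynomial (Fin n) K) :=
  weightedHomogeneousSubmodule K (fun _ => (1 : ℤ)) d

noncomputable instance : GradedAlgebra (intPiece K n) :=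
  weightedGradedAlgebra K (fun _ : Fin n => (1 : ℤ))

variable {K n}

lemma mem_intPiece {d : ℤ} {p : MvPolynomial (Fin n) K} :
    p ∈ intPiece K n d ↔ ∀ m, coeff m p ≠ 0 → (m.degree : ℤ) = d := by
  have (m : Fin n →₀ ℕ) : Finsupp.weight (fun _ => (1 : ℤ)) m = m.degree := by
    simp [Finsupp.weight_apply, Finsupp.degree_apply, Finsupp.sum]
  unfold intPiece
  rw [mem_weightedHomogeneousSubmodule]
  exact forall_congr' fun m => by rw [this]

lemma intPiece_natCast (d : ℕ) : intPiece K n d = homogeneousSubmodule (Fin n) K d := by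
  ext p
  rw [mem_intPiece, mem_homogeneousSubmodule, IsHomogeneous, IsWeightedHomogeneous]
  refine forall_congr' fun m => ?_
  rw [Nat.cast_inj, Finsupp.degree_eq_weight_one]
  rfl

lemma intPiece_one : intPiece K n 1 = homogeneousSubmodule (Fin n) K 1 := intPiece_natCast 1

lemma mem_intPiece_natCast {d : ℕ} {p : MvPolynomial (Fin n) K} :
    p ∈ intPiece K n d ↔ p.IsHomogeneous d := by
  rw [intPiece_natCast, mem_homogeneousSubmodule]

lemma mem_intPiece_one {p : MvPolynomial (Fin n) K} :
    p ∈ intPiece K n 1 ↔ p.IsHomogeneous 1 := by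
  rw [intPiece_one, mem_homogeneousSubmodule]

lemma intPiece_of_neg {d : ℤ} (hd : d < 0) : intPiece K n d = ⊥ := by
  rw [eq_bot_iff]
  intro p hp
  rw [mem_intPiece] at hp
  rw [Submodule.mem_bot]
  ext m
  by_contra h
  have := hp m h
  omega

instance (d : ℤ) : FiniteDimensional K (intPiece K n d) := by
  rcases lt_or_ge d 0 with h | h
  · rw [intPiece_of_neg h]
    infer_instance
  · obtain ⟨e, rfl⟩ := Int.eq_ofNat_of_zero_le h
    rw [intPiece_natCast]
    exact Module.Finite.iff_fg.2 (homogeneousSubmodule_fg (Fin n) K e)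

lemma span_isHomogeneous_intPiece {s : Set (MvPolynomial (Fin n) K)}
    (hs : ∀ p ∈ s, ∃ d, p ∈ intPiece K n d) : (Ideal.span s).IsHomogeneous (intPiece K n) :=
  Ideal.homogeneous_span _ _ hs

lemma constantCoeff_eq_zero_of_mem_intPiece {d : ℤ} (hd : d ≠ 0) {p : MvPolynomial (Fin n) K}
    (hp : p ∈ intPiece K n d) : constantCoeff p = 0 := by
  by_contra h
  exact hd (by simpa using (mem_intPiece.1 hp 0 h).symm)

lemma one_notMem_span {s : Set (MvPolynomial (Fin n) K)}
    (hs : ∀ p ∈ s, ∃ d ≠ 0, p ∈ intPiece K n d) : (1 : MvPolynomial (Fin n) K) ∉ Ideal.span s := by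
  intro h
  have hle : Ideal.span s ≤ RingHom.ker (constantCoeff (R := K) (σ := Fin n)) := by
    rw [Ideal.span_le]
    intro p hp
    obtain ⟨d, hd, hpd⟩ := hs p hp
    exact constantCoeff_eq_zero_of_mem_intPiece hd hpd
  simpa using hle h

end IntGrading

section LinearizedSystem

variable {K : Type*} [Field K] {n : ℕ}

/-- A homogeneous system `f` all of whose rearrangements starting with the members indexed by `L`
are regular sequences, where the members indexed by `L` are linear forms, those outside `L` have
degrees prescribed by `D`, and those in `S \ L` are products of linear forms. -/
structure LinearizedSystem (D : Fin n → ℕ) (S L : Finset (Fin n))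
    (f : Fin n → MvPolynomial (Fin n) K) : Prop where
  mem_piece : ∀ i ∉ L, f i ∈ intPiece K n (D i)
  mem_one : ∀ i ∈ L, f i ∈ intPiece K n 1
  linearIndepOn : LinearIndepOn K f (L : Set (Fin n))
  mem_of_mul_mem : ∀ T : Finset (Fin n), L ⊆ T → ∀ j ∉ T, ∀ x,
    f j * x ∈ Ideal.span (f '' T) → x ∈ Ideal.span (f '' T)
  split : ∀ j ∈ S, j ∉ L → ∃ s : Multiset (MvPolynomial (Fin n) K),
    s.card = D j ∧ (∀ ℓ ∈ s, ℓ ∈ intPiece K n 1) ∧ f j = s.prod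

namespace LinearizedSystem

variable {D : Fin n → ℕ} {S L : Finset (Fin n)} {f : Fin n → MvPolynomial (Fin n) K}

lemma isHomogeneous (hf : LinearizedSystem D S L f) (T : Set (Fin n)) :
    (Ideal.span (f '' T)).IsHomogeneous (intPiece K n) := by
  refine span_isHomogeneous_intPiece ?_
  rintro _ ⟨i, -, rfl⟩
  by_cases hi : i ∈ L
  · exact ⟨_, hf.mem_one i hi⟩
  · exact ⟨_, hf.mem_piece i hi⟩

lemma sup_span_singleton_eq {J : Ideal (MvPolynomial (Fin n) K)} {a b : MvPolynomial (Fin n) K}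
    (h : a - b ∈ J) : J ⊔ Ideal.span {a} = J ⊔ Ideal.span {b} := by
  apply le_antisymm
  · refine sup_le le_sup_left ?_
    rw [Ideal.span_singleton_le_iff_mem, ← sub_add_cancel a b]
    exact Submodule.add_mem_sup h (Ideal.mem_span_singleton_self b)
  · refine sup_le le_sup_left ?_
    rw [Ideal.span_singleton_le_iff_mem, ← sub_sub_cancel a b, sub_eq_neg_add]
    exact Submodule.add_mem_sup (neg_mem h) (Ideal.mem_span_singleton_self a)

lemma span_image_of_mem (g : Fin n → MvPolynomial (Fin n) K) {T : Finset (Fin n)} {j : Fin n}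
    (hj : j ∈ T) : Ideal.span (g '' T) =
      Ideal.span (g '' (T.erase j : Finset (Fin n))) ⊔ Ideal.span {g j} := by
  conv_lhs => rw [← Finset.insert_erase hj, Finset.coe_insert, Set.image_insert_eq,
    Set.insert_eq, Ideal.span_union, sup_comm]

lemma mem_of_prod_mul_mem (hf : LinearizedSystem D S L f) {j : Fin n} {T : Finset (Fin n)}
    (hLT : L ⊆ T) (hj : j ∉ T) {p : MvPolynomial (Fin n) K}
    (hp : f j - p ∈ Ideal.span (f '' L)) {x : MvPolynomial (Fin n) K}
    (hx : p * x ∈ Ideal.span (f '' T)) : x ∈ Ideal.span (f '' T) := by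
  refine hf.mem_of_mul_mem T hLT j hj x ?_
  rw [show f j * x = (f j - p) * x + p * x by ring]
  exact add_mem (Ideal.mul_mem_right _ _ (Ideal.span_mono (Set.image_mono hLT) hp)) hx

lemma mem_of_dvd_mul_mem (hf : LinearizedSystem D S L f) {j : Fin n} {T : Finset (Fin n)}
    (hLT : L ⊆ T) (hj : j ∉ T) {p u : MvPolynomial (Fin n) K}
    (hp : f j - p ∈ Ideal.span (f '' L)) (hu : u ∣ p) (x : MvPolynomial (Fin n) K)
    (hx : u * x ∈ Ideal.span (f '' T)) : x ∈ Ideal.span (f '' T) := by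
  obtain ⟨v, rfl⟩ := hu
  refine hf.mem_of_prod_mul_mem hLT hj hp ?_
  rw [mul_comm u, mul_assoc]
  exact Ideal.mul_mem_left _ _ hx

lemma update_linear (hf : LinearizedSystem D S L f) {j : Fin n} (hj : j ∉ L)
    {ℓ u : MvPolynomial (Fin n) K} (hp : f j - ℓ * u ∈ Ideal.span (f '' L))
    (hℓ : ℓ ∈ intPiece K n 1) :
    LinearizedSystem D S (insert j L) (Function.update f j ℓ) where
  mem_piece i hi := by
    rw [Finset.mem_insert, not_or] at hi
    rw [Function.update_of_ne hi.1]
    exact hf.mem_piece i hi.2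
  mem_one i hi := by
    rcases eq_or_ne i j with rfl | hij
    · rwa [Function.update_self]
    · rw [Function.update_of_ne hij]
      exact hf.mem_one i (Finset.mem_of_mem_insert_of_ne hi hij)
  linearIndepOn := by
    have heq : Set.EqOn f (Function.update f j ℓ) L := fun i hi =>
      (Function.update_of_ne (fun h : i = j => hj (h ▸ hi)) _ _).symm
    rw [Finset.coe_insert, linearIndepOn_insert (by simpa using hj)]
    refine ⟨hf.linearIndepOn.congr heq, ?_⟩
    rw [← heq.image_eq, Function.update_self]
    intro h
    have h1 : ℓ ∈ Ideal.span (f '' L) :=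
      Submodule.span_le_restrictScalars K (MvPolynomial (Fin n) K) _ h
    refine one_notMem_span (s := f '' L) ?_ (hf.mem_of_prod_mul_mem subset_rfl hj hp
      (x := 1) (Ideal.mul_mem_right _ _ (Ideal.mul_mem_right _ _ h1)))
    rintro _ ⟨i, hi, rfl⟩
    exact ⟨1, one_ne_zero, hf.mem_one i hi⟩
  mem_of_mul_mem T hLT k hk x hx := by
    have hjT : j ∈ T := hLT (Finset.mem_insert_self j L)
    have hkj : k ≠ j := fun h => hk (h ▸ hjT)
    have hLT' : L ⊆ T.erase j := fun i hi =>
      Finset.mem_erase.2 ⟨fun h => hj (h ▸ hi), hLT (Finset.mem_insert_of_mem hi)⟩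
    have himg : Function.update f j ℓ '' (T.erase j : Finset (Fin n)) =
        f '' (T.erase j : Finset (Fin n)) :=
      Set.image_congr fun i hi => Function.update_of_ne (Finset.ne_of_mem_erase hi) _ _
    have hsp : Ideal.span (f '' T) =
        Ideal.span (f '' (T.erase j : Finset (Fin n))) ⊔ Ideal.span {u * ℓ} := by
      rw [span_image_of_mem f hjT]
      refine sup_span_singleton_eq (Ideal.span_mono (Set.image_mono hLT') ?_)
      rwa [mul_comm u]
    rw [span_image_of_mem _ hjT, himg, Function.update_self] at hx ⊢
    rw [Function.update_of_ne hkj] at hx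
    refine mem_sup_span_singleton_of_mul_mem (ℓ := u)
      (hf.mem_of_dvd_mul_mem hLT' (Finset.notMem_erase j T) hp (Dvd.intro_left ℓ rfl)) ?_
    rw [← hsp]
    refine hf.mem_of_mul_mem T ((Finset.subset_insert j L).trans hLT) k hk _ ?_
    rw [hsp, mul_left_comm]
    exact mul_mem_sup_span_singleton hx
  split k hkS hk := by
    rw [Finset.mem_insert, not_or] at hk
    rw [Function.update_of_ne hk.1]
    exact hf.split k hkS hk.2

lemma span_range_update (f : Fin n → MvPolynomial (Fin n) K) (j : Fin n)
    (ℓ : MvPolynomial (Fin n) K) :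
    Ideal.span (Set.range (Function.update f j ℓ)) =
      Ideal.span (f '' ((Finset.univ.erase j : Finset (Fin n)) : Set (Fin n))) ⊔
        Ideal.span {ℓ} := by
  rw [← Set.image_univ, ← Finset.coe_univ, span_image_of_mem _ (Finset.mem_univ j),
    Function.update_self]
  congr 2
  exact Set.image_congr fun i hi => Function.update_of_ne (Finset.ne_of_mem_erase hi) _ _

lemma span_range_eq_sup {j : Fin n} (hj : j ∉ L)
    {p : MvPolynomial (Fin n) K} (hp : f j - p ∈ Ideal.span (f '' L)) :
    Ideal.span (Set.range f) =
      Ideal.span (f '' ((Finset.univ.erase j : Finset (Fin n)) : Set (Fin n))) ⊔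
        Ideal.span {p} := by
  conv_lhs => rw [← Function.update_eq_self j f]
  rw [span_range_update]
  refine sup_span_singleton_eq (Ideal.span_mono (Set.image_mono ?_) hp)
  intro i hi
  simpa using fun h : i = j => hj (h ▸ hi)

end LinearizedSystem

/-- The properties of Hilbert functions of complete intersections used in the induction. -/
structure IsGoodHilbertFunction (h : ℤ → ℝ) : Prop where
  nonneg : ∀ d, 0 ≤ h d
  logConcave : StronglyLogConcave h
  pos_zero : 0 < h 0
  eventually_zero : ∃ N : ℤ, ∀ d ≥ N, h d = 0

lemma IsGoodHilbertFunction.windowSum {h : ℤ → ℝ} (hh : IsGoodHilbertFunction h) {a : ℕ}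
    (ha : 0 < a) : IsGoodHilbertFunction (windowSum a h) where
  nonneg := windowSum_nonneg hh.nonneg a
  logConcave := hh.logConcave.windowSum a
  pos_zero := by
    refine hh.pos_zero.trans_le ?_
    have := Finset.single_le_sum (f := fun i : ℕ => h (0 - i)) (fun i _ => hh.nonneg _)
      (Finset.mem_range.2 ha)
    simpa [_root_.windowSum] using this
  eventually_zero := by
    obtain ⟨N, hN⟩ := hh.eventually_zero
    refine ⟨N + a, fun d hd => Finset.sum_eq_zero fun i hi => hN _ ?_⟩
    have := Finset.mem_range.1 hi
    omega

lemma isGoodHilbertFunction_single : IsGoodHilbertFunction (Pi.single 0 1) where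
  nonneg d := by
    rcases eq_or_ne d 0 with rfl | h
    · simp
    · simp [h]
  logConcave x y hxy := by
    rcases eq_or_ne x 0 with rfl | h
    · rw [Pi.single_eq_of_ne (by omega : y + 1 ≠ 0), mul_zero,
        Pi.single_eq_of_ne (by omega : (0 : ℤ) + 1 ≠ 0), zero_mul]
    · rw [Pi.single_eq_of_ne h, zero_mul]
      have (z : ℤ) : 0 ≤ (Pi.single 0 1 : ℤ → ℝ) z := by
        rcases eq_or_ne z 0 with rfl | h
        · simp
        · simp [h]
      exact mul_nonneg (this _) (this _)
  pos_zero := by simp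
  eventually_zero := ⟨1, fun d hd => Pi.single_eq_of_ne (by omega) _⟩

end LinearizedSystem

section BinaryForms

variable {K : Type*} [Field K]

lemma exists_multiset_prod_eq_C_mul_prod {σ : Type*} (c : K)
    {s : Multiset (MvPolynomial σ K)} (hs0 : s ≠ 0) (hs : ∀ ℓ ∈ s, ℓ.IsHomogeneous 1) :
    ∃ t : Multiset (MvPolynomial σ K), t.card = s.card ∧ (∀ ℓ ∈ t, ℓ.IsHomogeneous 1) ∧
      C c * s.prod = t.prod := by
  obtain ⟨ℓ, hℓ⟩ := Multiset.exists_mem_of_ne_zero hs0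
  obtain ⟨r, rfl⟩ := Multiset.exists_cons_of_mem hℓ
  refine ⟨(C c * ℓ) ::ₘ r, by simp, ?_, by simp [mul_assoc]⟩
  intro l hl
  rcases Multiset.mem_cons.1 hl with rfl | hl
  · exact (hs ℓ hℓ).C_mul c
  · exact hs l (Multiset.mem_cons_of_mem hl)

lemma homogenize_prod_X_sub_C (t : Multiset K) :
    ((t.map fun r => (Polynomial.X - Polynomial.C r)).prod).homogenize t.card =
      (t.map fun r => (X 0 - C r * X 1 : MvPolynomial (Fin 2) K)).prod := by
  induction t using Multiset.induction_on with
  | empty => simp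
  | cons a t ih =>
    rw [Multiset.map_cons, Multiset.prod_cons, Multiset.card_cons, Multiset.map_cons,
      Multiset.prod_cons, add_comm, Polynomial.homogenize_mul, ih]
    · congr 1
      rw [Polynomial.homogenize_sub, Polynomial.homogenize_X one_ne_zero, Polynomial.homogenize_C]
      simp
    · exact Polynomial.natDegree_X_sub_C_le a
    · rw [Polynomial.natDegree_multiset_prod_X_sub_C_eq_card]

/-- Over an algebraically closed field, binary forms are products of linear forms. -/
lemma exists_multiset_prod_eq_of_isHomogeneous_fin_two [IsAlgClosed K] {a : ℕ} (ha : 0 < a)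
    {p : MvPolynomial (Fin 2) K} (hp : p.IsHomogeneous a) :
    ∃ s : Multiset (MvPolynomial (Fin 2) K), s.card = a ∧ (∀ ℓ ∈ s, ℓ.IsHomogeneous 1) ∧
      p = s.prod := by
  set q : Polynomial K := aeval ![Polynomial.X, 1] p with hq
  have hpq : q.homogenize a = p := Polynomial.homogenize_eq_of_isHomogeneous hp rfl
  have hdeg : q.natDegree ≤ a := by
    have := aeval_natDegree_le p hp.totalDegree_le ![(Polynomial.X : Polynomial K), 1] (n := 1)
      (by intro i; fin_cases i <;> simp)
    simpa using this
  have hsplit := IsAlgClosed.splits q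
  have hcard : q.roots.card = q.natDegree := hsplit.natDegree_eq_card_roots.symm
  have hprod : q = Polynomial.C q.leadingCoeff *
      ((q.roots.map fun r => (Polynomial.X - Polynomial.C r)).prod * 1) := by
    rw [mul_one]
    exact hsplit.eq_prod_roots
  set s : Multiset (MvPolynomial (Fin 2) K) :=
    (q.roots.map fun r => (X 0 - C r * X 1 : MvPolynomial (Fin 2) K)) +
      Multiset.replicate (a - q.natDegree) (X 1) with hs
  have hscard : s.card = a := by
    simp [hs, hcard]
    omega
  have hps : p = C q.leadingCoeff * s.prod := by
    rw [← hpq]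
    conv_lhs => rw [hprod]
    rw [Polynomial.homogenize_C_mul, show a = q.roots.card + (a - q.natDegree) by omega,
      Polynomial.homogenize_mul, homogenize_prod_X_sub_C, Polynomial.homogenize_one]
    · simp [hs]
    · rw [Polynomial.natDegree_multiset_prod_X_sub_C_eq_card]
    · simp
  obtain ⟨t, ht, htl, htp⟩ := exists_multiset_prod_eq_C_mul_prod q.leadingCoeff (s := s)
    (by rintro h; rw [h] at hscard; simp at hscard; omega)
    (by
      intro ℓ hℓ
      rw [hs, Multiset.mem_add] at hℓ
      rcases hℓ with h | h
      · obtain ⟨r, -, rfl⟩ := Multiset.mem_map.1 h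
        exact (isHomogeneous_X K 0).sub ((isHomogeneous_X K 1).C_mul r)
      · rw [Multiset.eq_of_mem_replicate h]
        exact isHomogeneous_X K 1)
  exact ⟨t, ht.trans hscard, htl, hps.trans htp⟩

lemma exists_finrank_le_sup_span_singleton {M : Type*} [AddCommGroup M] [Module K M]
    {W H : Submodule K M} [FiniteDimensional K H] (hWH : W ≤ H) {k : ℕ}
    (h : finrank K H ≤ finrank K W + (k + 1)) :
    ∃ u ∈ H, finrank K H ≤ finrank K (W ⊔ Submodule.span K {u} : Submodule K M) + k := by
  rcases hWH.eq_or_lt with rfl | hlt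
  · have : W ⊔ Submodule.span K {0} = W := by simp
    exact ⟨0, zero_mem _, by rw [this]; omega⟩
  · obtain ⟨u, huH, huW⟩ := SetLike.exists_of_lt hlt
    refine ⟨u, huH, ?_⟩
    have hle : W ⊔ Submodule.span K {u} ≤ H :=
      sup_le hWH ((Submodule.span_singleton_le_iff_mem _ _).2 huH)
    have := Submodule.finiteDimensional_of_le hle
    have hlt' : W < W ⊔ Submodule.span K {u} := lt_of_le_of_ne le_sup_left fun he =>
      huW (he ▸ Submodule.mem_sup_right (Submodule.mem_span_singleton_self u))
    have := Submodule.finrank_lt_finrank_of_lt hlt'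
    omega

lemma finrank_homogeneousSubmodule_one_le (n : ℕ) :
    finrank K (homogeneousSubmodule (Fin n) K 1) ≤ n := by
  rw [homogeneousSubmodule_one_eq_span_X]
  have := finrank_range_le_card (R := K) (X : Fin n → MvPolynomial (Fin n) K)
  rwa [Fintype.card_fin] at this

end BinaryForms

section Induction

variable {K : Type*} [Field K] {n : ℕ} {D : Fin n → ℕ} {S L : Finset (Fin n)}
  {f : Fin n → MvPolynomial (Fin n) K}

namespace LinearizedSystem

lemma span_image_le_homogeneousSubmodule (hf : LinearizedSystem D S L f) :
    Submodule.span K (f '' L) ≤ homogeneousSubmodule (Fin n) K 1 := by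
  rw [Submodule.span_le]
  rintro _ ⟨i, hi, rfl⟩
  exact mem_intPiece_one.1 (hf.mem_one i hi)

lemma finrank_span_image (hf : LinearizedSystem D S L f) :
    finrank K (Submodule.span K (f '' L)) = L.card := by
  have := finrank_span_eq_card hf.linearIndepOn.linearIndependent
  rw [Set.image_eq_range]
  simpa using this

lemma exists_split [IsAlgClosed K] (hf : LinearizedSystem D S L f) (hD : ∀ i, 0 < D i)
    {j : Fin n} (hj : j ∉ L) (h : j ∈ S ∨ n - 2 ≤ L.card) :
    ∃ s : Multiset (MvPolynomial (Fin n) K), s.card = D j ∧ (∀ ℓ ∈ s, ℓ ∈ intPiece K n 1) ∧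
      f j - s.prod ∈ Ideal.span (f '' L) := by
  rcases h with h | h
  · obtain ⟨s, h1, h2, h3⟩ := hf.split j h hj
    exact ⟨s, h1, h2, by simp [h3]⟩
  have hg : (f j).IsHomogeneous (D j) := mem_intPiece_natCast.1 (hf.mem_piece j hj)
  set J := Ideal.span (f '' L)
  set W := Submodule.span K (f '' L) with hW
  set H := homogeneousSubmodule (Fin n) K 1 with hH
  have : FiniteDimensional K H := Module.Finite.iff_fg.2 (homogeneousSubmodule_fg (Fin n) K 1)
  have hHn : finrank K H ≤ n := finrank_homogeneousSubmodule_one_le n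
  have hWL : finrank K W = L.card := hf.finrank_span_image
  have hWH : W ≤ H := hf.span_image_le_homogeneousSubmodule
  obtain ⟨u, hu, h1⟩ := exists_finrank_le_sup_span_singleton hWH (k := 1) (by omega)
  have hWH1 := sup_le hWH ((Submodule.span_singleton_le_iff_mem u H).2 hu)
  obtain ⟨w, hw, h2⟩ := exists_finrank_le_sup_span_singleton hWH1 (k := 0) (by omega)
  have hWH2 := sup_le hWH1 ((Submodule.span_singleton_le_iff_mem w H).2 hw)
  have heq := Submodule.eq_of_le_of_finrank_le hWH2 (by omega)
  have hX : ∀ i : Fin n, ∃ α β : K, X i - (C α * u + C β * w) ∈ J := by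
    intro i
    have hi : X i ∈ H := isHomogeneous_X K i
    rw [← heq] at hi
    obtain ⟨y, hy, z, hz, hyz⟩ := Submodule.mem_sup.1 hi
    obtain ⟨x, hx, v, hv, rfl⟩ := Submodule.mem_sup.1 hy
    obtain ⟨α, rfl⟩ := Submodule.mem_span_singleton.1 hv
    obtain ⟨β, rfl⟩ := Submodule.mem_span_singleton.1 hz
    refine ⟨α, β, ?_⟩
    rw [← hyz, ← smul_eq_C_mul, ← smul_eq_C_mul, add_assoc, add_sub_cancel_right]
    exact Submodule.span_le_restrictScalars K (MvPolynomial (Fin n) K) _ hx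
  choose α β hαβ using hX
  set p : MvPolynomial (Fin 2) K :=
    aeval (fun i => C (α i) * X 0 + C (β i) * X 1 : Fin n → MvPolynomial (Fin 2) K) (f j) with hp
  have hphom : p.IsHomogeneous (D j) := by
    have := hg.aeval (fun i => C (α i) * X 0 + C (β i) * X 1 : Fin n → MvPolynomial (Fin 2) K)
      (n := 1) fun i => ((isHomogeneous_X K 0).C_mul _).add ((isHomogeneous_X K 1).C_mul _)
    rwa [one_mul] at this
  obtain ⟨s, hs1, hs2, hs3⟩ := exists_multiset_prod_eq_of_isHomogeneous_fin_two (hD j) hphom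
  refine ⟨s.map (aeval ![u, w]), by simpa using hs1, ?_, ?_⟩
  · intro ℓ hℓ
    obtain ⟨l, hl, rfl⟩ := Multiset.mem_map.1 hℓ
    have := (hs2 l hl).aeval ![u, w] (n := 1) (by
      intro i
      fin_cases i
      · exact hu
      · exact hw)
    exact mem_intPiece_one.2 (by simpa using this)
  · rw [Multiset.prod_hom, ← hs3, hp, ← Ideal.Quotient.eq]
    have hhom : Ideal.Quotient.mkₐ K J = (Ideal.Quotient.mkₐ K J).comp ((aeval ![u, w]).comp
        (aeval (fun i => C (α i) * X 0 + C (β i) * X 1 :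
          Fin n → MvPolynomial (Fin 2) K))) := by
      refine algHom_ext fun i => ?_
      have := (Ideal.Quotient.eq (I := J)).2 (hαβ i)
      simpa [algebraMap_eq] using this
    exact DFunLike.congr_fun hhom (f j)

end LinearizedSystem

end Induction

section HilbertFunction

variable {K : Type*} [Field K] {n : ℕ} {D : Fin n → ℕ} {S L : Finset (Fin n)}
  {f : Fin n → MvPolynomial (Fin n) K}

lemma mem_of_mem_intPiece_of_X_mem {J : Ideal (MvPolynomial (Fin n) K)} (hJ : ∀ i, X i ∈ J) {d : ℤ}
    (hd : d ≠ 0) {p : MvPolynomial (Fin n) K} (hp : p ∈ intPiece K n d) : p ∈ J := by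
  have hle : Ideal.span (X '' (Set.univ : Set (Fin n))) ≤ J := by
    rw [Ideal.span_le]
    rintro _ ⟨i, -, rfl⟩
    exact hJ i
  refine hle (mem_ideal_span_X_image.2 fun m hm => ?_)
  have hm' := mem_intPiece.1 hp m (mem_support_iff.1 hm)
  by_contra! h
  have : m = 0 := Finsupp.ext fun i => h i (Set.mem_univ i)
  rw [this] at hm'
  simp at hm'
  exact hd hm'.symm

lemma quotDim_eq_zero_of_le {J : Ideal (MvPolynomial (Fin n) K)}
    {V : Submodule K (MvPolynomial (Fin n) K)} (h : V ≤ J.restrictScalars K) :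
    quotDim J V = 0 := by
  have h0 : V.map (Ideal.Quotient.mkₐ K J).toLinearMap = ⊥ :=
    LinearMap.le_ker_iff_map.1 (h.trans (ker_mkₐ_toLinearMap J).ge)
  rw [quotDim, h0, finrank_bot]

lemma quotDim_intPiece_of_X_mem {J : Ideal (MvPolynomial (Fin n) K)} (hJ : ∀ i, X i ∈ J)
    (h1 : 1 ∉ J) (d : ℤ) : (quotDim J (intPiece K n d) : ℝ) = (Pi.single 0 1 : ℤ → ℝ) d := by
  rcases eq_or_ne d 0 with rfl | hd
  · have h0 : intPiece K n 0 = Submodule.span K {1} := by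
      rw [show (0 : ℤ) = ((0 : ℕ) : ℤ) from rfl, intPiece_natCast, homogeneousSubmodule_zero,
        Submodule.one_eq_span]
    rw [h0, quotDim, Submodule.map_span, Set.image_singleton, finrank_span_singleton]
    · simp
    · simpa using h1 ∘ Ideal.Quotient.eq_zero_iff_mem.1
  · rw [Pi.single_eq_of_ne hd, quotDim_eq_zero_of_le
      (fun p hp => mem_of_mem_intPiece_of_X_mem hJ hd hp), Nat.cast_zero]

lemma hasNormalizedMatching_of_X_mem {J : Ideal (MvPolynomial (Fin n) K)} (hJ : ∀ i, X i ∈ J) :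
    HasNormalizedMatching (intPiece K n) J := by
  intro d V hV
  rcases eq_or_ne (d + 1) 0 with hd | hd
  · have h0 : V ≤ J.restrictScalars K :=
      hV.trans fun p hp => mem_of_mem_intPiece_of_X_mem hJ (by omega : d ≠ 0) hp
    rw [quotDim_eq_zero_of_le h0, zero_mul]
    exact Nat.zero_le _
  · rw [quotDim_eq_zero_of_le fun p hp => mem_of_mem_intPiece_of_X_mem hJ hd hp, mul_zero]
    exact Nat.zero_le _

namespace LinearizedSystem

lemma X_mem_span_range (hf : LinearizedSystem D S Finset.univ f) (i : Fin n) :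
    X i ∈ Ideal.span (Set.range f) := by
  have : FiniteDimensional K (homogeneousSubmodule (Fin n) K 1) :=
    Module.Finite.iff_fg.2 (homogeneousSubmodule_fg (Fin n) K 1)
  have heq := Submodule.eq_of_le_of_finrank_le hf.span_image_le_homogeneousSubmodule (by
    rw [hf.finrank_span_image, Finset.card_univ, Fintype.card_fin]
    exact finrank_homogeneousSubmodule_one_le n)
  have hi : X i ∈ homogeneousSubmodule (Fin n) K 1 := isHomogeneous_X K i
  rw [← heq, Finset.coe_univ, Set.image_univ] at hi
  exact Submodule.span_le_restrictScalars K (MvPolynomial (Fin n) K) _ hi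

lemma one_notMem_span_range (hf : LinearizedSystem D S L f) (hD : ∀ i, 0 < D i) :
    1 ∉ Ideal.span (Set.range f) := by
  refine one_notMem_span ?_
  rintro _ ⟨i, rfl⟩
  by_cases hi : i ∈ L
  · exact ⟨1, one_ne_zero, hf.mem_one i hi⟩
  · exact ⟨D i, by have := hD i; omega, hf.mem_piece i hi⟩

/-- The quotients by all linearizations with respect to `L` share the same Hilbert function, and
have normalized matching. -/
theorem exists_hilbertFunction [IsAlgClosed K] (hD : ∀ i, 0 < D i) (hS : n - 2 ≤ S.card) (m : ℕ) :
    ∀ L : Finset (Fin n), Lᶜ.card = m → ∃ h : ℤ → ℝ, IsGoodHilbertFunction h ∧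
      ∀ f : Fin n → MvPolynomial (Fin n) K, LinearizedSystem D S L f →
        (∀ d, (quotDim (Ideal.span (Set.range f)) (intPiece K n d) : ℝ) = h d) ∧
        HasNormalizedMatching (intPiece K n) (Ideal.span (Set.range f)) := by
  induction m with
  | zero =>
    intro L hL
    obtain rfl : L = Finset.univ := by simpa using hL
    exact ⟨_, isGoodHilbertFunction_single, fun f hf =>
      ⟨quotDim_intPiece_of_X_mem hf.X_mem_span_range (hf.one_notMem_span_range hD),
        hasNormalizedMatching_of_X_mem hf.X_mem_span_range⟩⟩
  | succ m ih =>
    intro L hL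
    obtain ⟨j, hjL, hj⟩ : ∃ j ∉ L, j ∈ S ∨ n - 2 ≤ L.card := by
      by_cases hSL : S ⊆ L
      · obtain ⟨j, hj⟩ := Finset.card_pos.1 (by omega : 0 < Lᶜ.card)
        exact ⟨j, Finset.mem_compl.1 hj, Or.inr (hS.trans (Finset.card_le_card hSL))⟩
      · obtain ⟨j, hjS, hjL⟩ := Finset.not_subset.1 hSL
        exact ⟨j, hjL, Or.inl hjS⟩
    obtain ⟨h, hgood, hh⟩ := ih (insert j L) (by
      rw [Finset.card_compl, Finset.card_insert_of_notMem hjL]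
      rw [Finset.card_compl] at hL
      omega)
    refine ⟨_, hgood.windowSum (hD j), fun f hf => ?_⟩
    obtain ⟨s, hcard, hs1, hsp⟩ := hf.exists_split hD hjL hj
    set J := Ideal.span (f '' ((Finset.univ.erase j : Finset (Fin n)) : Set (Fin n)))
    have hJ : J.IsHomogeneous (intPiece K n) := hf.isHomogeneous _
    have hL' : L ⊆ Finset.univ.erase j := fun i hi =>
      Finset.mem_erase.2 ⟨fun h => hjL (h ▸ hi), Finset.mem_univ i⟩
    have key : ∀ ℓ ∈ s, ℓ ∈ intPiece K n 1 ∧ (∀ x, ℓ * x ∈ J → x ∈ J) ∧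
        (∀ e, (quotDim (J ⊔ Ideal.span {ℓ}) (intPiece K n e) : ℝ) = h e) ∧
        HasNormalizedMatching (intPiece K n) (J ⊔ Ideal.span {ℓ}) := by
      intro ℓ hℓ
      obtain ⟨t, rfl⟩ := Multiset.exists_cons_of_mem hℓ
      have hupd := hh _ (hf.update_linear hjL (ℓ := ℓ) (u := t.prod)
        (by rwa [← Multiset.prod_cons]) (hs1 ℓ hℓ))
      rw [span_range_update] at hupd
      exact ⟨hs1 ℓ hℓ, hf.mem_of_dvd_mul_mem hL' (Finset.notMem_erase j _) hsp
        (Multiset.dvd_prod hℓ), hupd⟩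
    rw [span_range_eq_sup hjL hsp]
    refine ⟨fun d => ?_, HasNormalizedMatching.sup_span_prod _ hJ hgood.logConcave s key ?_⟩
    · rw [quotDim_piece_eq_windowSum _ hJ h s fun ℓ hℓ =>
        ⟨(key ℓ hℓ).1, (key ℓ hℓ).2.1, (key ℓ hℓ).2.2.1⟩, hcard]
    · rintro rfl
      have := hD j
      simp at hcard
      omega

end LinearizedSystem

end HilbertFunction

section Permutation

variable {K : Type*} [Field K] {n : ℕ}

lemma mem_of_forall_mem_sup_span_pow {J : Ideal (MvPolynomial (Fin n) K)}
    (hJ : J.IsHomogeneous (intPiece K n)) {e : ℕ} (he : 0 < e) {a : MvPolynomial (Fin n) K}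
    (ha : a ∈ intPiece K n e) {x : MvPolynomial (Fin n) K}
    (hx : ∀ k : ℕ, x ∈ J ⊔ Ideal.span {a ^ k}) : x ∈ J := by
  classical
  rw [← DirectSum.sum_support_decompose (intPiece K n) x]
  refine Ideal.sum_mem _ fun d _ => ?_
  set k := d.toNat + 1
  obtain ⟨y, hy, w, hw, hyw⟩ := Submodule.mem_sup.1 (hx k)
  obtain ⟨z, rfl⟩ := Ideal.mem_span_singleton'.1 hw
  have hak : a ^ k ∈ intPiece K n (k * e : ℕ) := by
    rw [mem_intPiece_natCast] at ha ⊢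
    rw [mul_comm]
    exact ha.pow k
  have hlt : d < (k * e : ℕ) := by
    have : k ≤ k * e := Nat.le_mul_of_pos_right k he
    omega
  have h1 := DirectSum.coe_decompose_mul_add_of_left_mem (intPiece K n)
    (j := d - (k * e : ℕ)) (b := z) hak
  have h2 : (DirectSum.decompose (intPiece K n) z (d - (k * e : ℕ)) :
      MvPolynomial (Fin n) K) = 0 := by
    have := SetLike.coe_mem (DirectSum.decompose (intPiece K n) z (d - (k * e : ℕ)))
    exact (Submodule.mem_bot K).1 ((intPiece_of_neg (by omega)).le this)
  rw [h2, mul_zero, add_sub_cancel] at h1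
  rw [← hyw, DirectSum.decompose_add, DirectSum.add_apply, Submodule.coe_add, mul_comm z, h1,
    add_zero]
  exact hJ d hy

open RingTheory.Sequence in
/-- A regular sequence of homogeneous polynomials of positive degree can be permuted. -/
lemma isWeaklyRegular_of_perm {rs rs' : List (MvPolynomial (Fin n) K)}
    (hrs : ∀ p ∈ rs, ∃ d : ℕ, 0 < d ∧ p ∈ intPiece K n d)
    (h : IsWeaklyRegular (MvPolynomial (Fin n) K) rs) (hperm : rs.Perm rs') :
    IsWeaklyRegular (MvPolynomial (Fin n) K) rs' := by
  refine h.prototype_perm hperm fun a b l hl => ?_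
  intro T hT
  obtain ⟨e, he, hae⟩ := hrs a (hl.subset List.mem_cons_self)
  have hJ : (Ideal.ofList l).IsHomogeneous (intPiece K n) := by
    refine span_isHomogeneous_intPiece fun p hp => ?_
    obtain ⟨d, -, hd⟩ := hrs p (hl.subset (List.mem_cons_of_mem _ (List.mem_cons_of_mem _ hp)))
    exact ⟨d, hd⟩
  have hpow : ∀ k : ℕ, ∀ y ∈ T, ∃ z ∈ T, y = a ^ k • z := by
    intro k
    induction k with
    | zero => exact fun y hy => ⟨y, hy, by simp⟩
    | succ k ih =>
      intro y hy
      obtain ⟨z, hz, rfl⟩ := ih y hy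
      rw [hT] at hz
      obtain ⟨w, hw, rfl⟩ := (Submodule.mem_smul_pointwise_iff_exists _ _ _).1 hz
      exact ⟨w, hw, by rw [pow_succ, mul_smul]⟩
  rw [eq_bot_iff]
  intro y hy
  obtain ⟨x, rfl⟩ := Submodule.Quotient.mk_surjective _ y
  rw [Submodule.mem_bot, Submodule.Quotient.mk_eq_zero]
  have hx : x ∈ Ideal.ofList l := by
    refine mem_of_forall_mem_sup_span_pow hJ he hae fun k => ?_
    obtain ⟨z, -, hz⟩ := hpow k _ hy
    obtain ⟨w, rfl⟩ := Submodule.Quotient.mk_surjective _ z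
    rw [← Submodule.Quotient.mk_smul, Submodule.Quotient.eq] at hz
    rw [smul_eq_mul, Ideal.mul_top] at hz
    rw [show x = (x - a ^ k • w) + w * a ^ k by rw [smul_eq_mul]; ring]
    exact Submodule.add_mem_sup hz (Ideal.mul_mem_left _ _ (Ideal.mem_span_singleton_self _))
  rwa [smul_eq_mul, Ideal.mul_top]

open RingTheory.Sequence in
lemma mem_span_image_of_mul_mem {f : Fin n → MvPolynomial (Fin n) K}
    (hf : ∀ j, ∃ d : ℕ, 0 < d ∧ f j ∈ intPiece K n d)
    (hreg : IsWeaklyRegular (MvPolynomial (Fin n) K) (List.ofFn f)) (T : Finset (Fin n))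
    {j : Fin n} (hj : j ∉ T) (x : MvPolynomial (Fin n) K) (hx : f j * x ∈ Ideal.span (f '' T)) :
    x ∈ Ideal.span (f '' T) := by
  have hperm : (List.ofFn f).Perm
      (T.toList.map f ++ (f j :: ((insert j T)ᶜ).toList.map f)) := by
    rw [List.ofFn_eq_map, ← List.map_cons, ← List.map_append]
    refine List.Perm.map f ((List.perm_ext_iff_of_nodup (List.nodup_finRange n) ?_).2 ?_)
    · rw [List.nodup_append]
      refine ⟨T.nodup_toList, List.nodup_cons.2 ⟨by simp, Finset.nodup_toList _⟩, ?_⟩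
      intro a ha b hb hab
      subst hab
      rw [Finset.mem_toList] at ha
      rcases List.mem_cons.1 hb with rfl | hb
      · exact hj ha
      · simp [ha] at hb
    · intro a
      by_cases ha : a ∈ T <;> by_cases haj : a = j <;> simp [ha, haj]
  have hreg' := isWeaklyRegular_of_perm (by
    intro p hp
    obtain ⟨i, rfl⟩ := List.mem_ofFn.1 hp
    exact hf i) hreg hperm
  rw [isWeaklyRegular_append_iff, isWeaklyRegular_cons_iff] at hreg'
  have hsm := hreg'.2.1
  have hJ : (Ideal.ofList (T.toList.map f) • ⊤ : Submodule (MvPolynomial (Fin n) K)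
      (MvPolynomial (Fin n) K)) = Ideal.span (f '' T) := by
    rw [smul_eq_mul, Ideal.mul_top, Ideal.ofList]
    congr 1
    ext p
    simp
  rw [← hJ] at hx ⊢
  rw [← Submodule.Quotient.mk_eq_zero] at hx ⊢
  refine hsm (?_ : f j • _ = f j • _)
  rw [← Submodule.Quotient.mk_smul, smul_zero]
  exact hx

lemma linearizedSystem_empty {f : Fin n → MvPolynomial (Fin n) K} {D : Fin n → ℕ}
    {S : Finset (Fin n)} (hD : ∀ i, 0 < D i) (hf : ∀ i, (f i).IsHomogeneous (D i))
    (hlin : ∀ j ∈ S, IsProductOfLinearForms (f j))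
    (hreg : RingTheory.Sequence.IsWeaklyRegular (MvPolynomial (Fin n) K) (List.ofFn f)) :
    LinearizedSystem D S ∅ f where
  mem_piece i _ := mem_intPiece_natCast.2 (hf i)
  mem_one i hi := absurd hi (Finset.notMem_empty i)
  linearIndepOn := by simp
  mem_of_mul_mem T _ j hj x hx := mem_span_image_of_mul_mem
    (fun i => ⟨D i, hD i, mem_intPiece_natCast.2 (hf i)⟩) hreg T hj x hx
  split j hjS _ := by
    obtain ⟨k, hk, g, hg, hfg⟩ := hlin j hjS
    rcases eq_or_ne (f j) 0 with h0 | h0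
    · refine ⟨Multiset.replicate (D j) 0, by simp, fun ℓ hℓ => ?_, ?_⟩
      · rw [Multiset.eq_of_mem_replicate hℓ]
        exact zero_mem _
      · simp [h0, (hD j).ne']
    · refine ⟨Finset.univ.val.map g, ?_, fun ℓ hℓ => ?_, hfg⟩
      · have h1 := IsHomogeneous.prod Finset.univ g (fun _ => 1) fun t _ => hg t
        rw [← hfg] at h1
        simpa using h1.inj_right (hf j) h0
      · obtain ⟨t, -, rfl⟩ := Multiset.mem_map.1 hℓ
        exact mem_intPiece_one.2 (hg t)

end Permutation

section Sperner

lemma sum_sub_le_of_normalized_matching {x y H : ℕ → ℝ} {M : ℝ} (hx : ∀ d, x d ≤ H d)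
    (hy : ∀ d, 0 ≤ y d) (hyx : ∀ d, y d ≤ x d) (hM : ∀ d, H d ≤ M)
    (h0 : ∀ d, H d = 0 → H (d + 1) = 0) (hxy : ∀ d, x d * H (d + 1) ≤ y (d + 1) * H d) (N : ℕ) :
    ∑ d ∈ Finset.range N, (x d - y d) ≤ M := by
  have hH : ∀ d, 0 ≤ H d := fun d => (hy d).trans ((hyx d).trans (hx d))
  have key : ∀ k : ℕ, ∃ r : ℝ, r ≤ 1 ∧ ∑ d ∈ Finset.range k, (x d - y d) ≤ M * r ∧
      r * H k ≤ y k := by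
    intro k
    induction k with
    | zero => exact ⟨0, zero_le_one, by simp, by simpa using hy 0⟩
    | succ k ih =>
      obtain ⟨r, hr1, hr, hrk⟩ := ih
      rw [Finset.sum_range_succ]
      rcases (hH k).eq_or_lt with hk | hk
      · refine ⟨r, hr1, ?_, ?_⟩
        · linarith [hx k, hy k]
        · rw [h0 k hk.symm, mul_zero]
          exact hy _
      · have hxk : x k / H k * H k = x k := div_mul_cancel₀ _ hk.ne'
        refine ⟨x k / H k, (div_le_one hk).2 (hx k), ?_, ?_⟩
        · have hle : r ≤ x k / H k := (le_div_iff₀ hk).2 (hrk.trans (hyx k))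
          nlinarith [mul_nonneg (sub_nonneg.2 hle) (sub_nonneg.2 (hM k))]
        · rw [div_mul_eq_mul_div]
          exact (div_le_iff₀ hk).2 (hxy k)
  obtain ⟨r, hr1, hr, -⟩ := key N
  exact hr.trans (mul_le_of_le_one_right ((hH 0).trans (hM 0)) hr1)

variable {K A : Type*} [Field K] [CommRing A] [Algebra K A]

lemma restrictScalars_mul_le (m I : Ideal A) :
    (m * I).restrictScalars K ≤ I.restrictScalars K :=
  Submodule.restrictScalars_mono (S := K) (Ideal.mul_le_right : m * I ≤ I)

lemma nu_add_finrank [FiniteDimensional K A] (m I : Ideal A) :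
    nu K m I + finrank K ((m * I).restrictScalars K) = finrank K (I.restrictScalars K) := by
  have hle := restrictScalars_mul_le (K := K) m I
  rw [nu, ← Submodule.finrank_quotient_add_finrank
    (Submodule.comap (I.restrictScalars K).subtype ((m * I).restrictScalars K)),
    LinearEquiv.finrank_eq (Submodule.comapSubtypeEquivOfLe hle)]

variable (ℬ : ℕ → Submodule K A) [GradedAlgebra ℬ]

/-- The subspace of elements whose homogeneous components of degree less than `d` vanish. -/
def orderFiltration (d : ℕ) : Submodule K A := ⨅ i < d, LinearMap.ker (GradedAlgebra.proj ℬ i)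

lemma mem_orderFiltration {d : ℕ} {x : A} :
    x ∈ orderFiltration ℬ d ↔ ∀ i < d, (DirectSum.decompose ℬ x i : A) = 0 := by
  simp [orderFiltration, GradedAlgebra.proj_apply]

lemma orderFiltration_succ (d : ℕ) :
    orderFiltration ℬ (d + 1) = orderFiltration ℬ d ⊓ LinearMap.ker (GradedAlgebra.proj ℬ d) := by
  ext x
  rw [Submodule.mem_inf, mem_orderFiltration, mem_orderFiltration, LinearMap.mem_ker,
    GradedAlgebra.proj_apply, Nat.forall_lt_succ_right]

/-- The space of leading forms of degree `d` of a subspace `X`. -/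
def leadingForms (X : Submodule K A) (d : ℕ) : Submodule K A :=
  (X ⊓ orderFiltration ℬ d).map (GradedAlgebra.proj ℬ d)

lemma leadingForms_le (X : Submodule K A) (d : ℕ) : leadingForms ℬ X d ≤ ℬ d := by
  rintro _ ⟨x, -, rfl⟩
  rw [GradedAlgebra.proj_apply]
  exact SetLike.coe_mem _

lemma leadingForms_mono {X Y : Submodule K A} (h : X ≤ Y) (d : ℕ) :
    leadingForms ℬ X d ≤ leadingForms ℬ Y d :=
  Submodule.map_mono (inf_le_inf_right _ h)

lemma eq_sum_decompose {N : ℕ} (hN : ∀ d ≥ N, ℬ d = ⊥) (x : A) :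
    x = ∑ i ∈ Finset.range N, (DirectSum.decompose ℬ x i : A) := by
  classical
  conv_lhs => rw [← DirectSum.sum_support_decompose ℬ x]
  refine Finset.sum_subset (fun i hi => ?_) fun i _ hi => ?_
  · by_contra h
    rw [Finset.mem_range, not_lt] at h
    rw [DFinsupp.mem_support_iff] at hi
    exact hi (Subtype.ext ((Submodule.mem_bot K).1 ((hN i h).le (SetLike.coe_mem _))))
  · rw [DFinsupp.notMem_support_iff.1 hi]
    rfl

lemma orderFiltration_eq_bot {N : ℕ} (hN : ∀ d ≥ N, ℬ d = ⊥) : orderFiltration ℬ N = ⊥ := by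
  rw [eq_bot_iff]
  intro x hx
  rw [Submodule.mem_bot, eq_sum_decompose ℬ hN x]
  exact Finset.sum_eq_zero fun i hi => (mem_orderFiltration ℬ).1 hx i (Finset.mem_range.1 hi)

lemma finrank_eq_sum_leadingForms [FiniteDimensional K A] {N : ℕ} (hN : ∀ d ≥ N, ℬ d = ⊥)
    (X : Submodule K A) :
    finrank K X = ∑ d ∈ Finset.range N, finrank K (leadingForms ℬ X d) := by
  have key : ∀ k : ℕ, finrank K X = ∑ d ∈ Finset.range k, finrank K (leadingForms ℬ X d) +
      finrank K (X ⊓ orderFiltration ℬ k : Submodule K A) := by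
    intro k
    induction k with
    | zero =>
      have h : orderFiltration ℬ 0 = ⊤ := eq_top_iff.2 fun x _ =>
        (mem_orderFiltration ℬ).2 fun i hi => absurd hi (Nat.not_lt_zero i)
      rw [h, inf_top_eq, Finset.sum_range_zero, zero_add]
    | succ k ih =>
      rw [ih, Finset.sum_range_succ, orderFiltration_succ, ← inf_assoc, leadingForms,
        ← finrank_map_add_finrank_inf_ker (GradedAlgebra.proj ℬ k)
          (X ⊓ orderFiltration ℬ k), add_assoc]
  rw [key N, orderFiltration_eq_bot ℬ hN, inf_bot_eq, finrank_bot, add_zero]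

lemma mul_leadingForms_le {m I : Ideal A} (hm : ∀ a ∈ ℬ 1, a ∈ m) (d : ℕ) :
    ℬ 1 * leadingForms ℬ (I.restrictScalars K) d ≤
      leadingForms ℬ ((m * I).restrictScalars K) (d + 1) := by
  rw [Submodule.mul_le]
  rintro a ha _ ⟨x, ⟨hxI, hx⟩, rfl⟩
  refine ⟨a * x, ⟨Ideal.mul_mem_mul (hm a ha) hxI, ?_⟩, ?_⟩
  · refine (mem_orderFiltration ℬ).2 fun i hi => ?_
    rcases i with _ | i
    · exact DirectSum.coe_decompose_mul_of_left_mem_of_not_le ℬ ha (by omega)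
    · rw [add_comm i 1, DirectSum.coe_decompose_mul_add_of_left_mem ℬ ha,
        (mem_orderFiltration ℬ).1 hx i (by omega), mul_zero]
  · rw [GradedAlgebra.proj_apply, GradedAlgebra.proj_apply, add_comm d 1,
      DirectSum.coe_decompose_mul_add_of_left_mem ℬ ha]

theorem isGreatest_nu_of_normalized_matching [FiniteDimensional K A] {N : ℕ}
    (hN : ∀ d ≥ N, ℬ d = ⊥)
    (hNM : ∀ d, ∀ V ≤ ℬ d, finrank K V * finrank K (ℬ (d + 1)) ≤
      finrank K (ℬ 1 * V : Submodule K A) * finrank K (ℬ d))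
    (h0 : ∀ d, finrank K (ℬ d) = 0 → finrank K (ℬ (d + 1)) = 0) {i₀ : ℕ}
    (hi₀ : ∀ i, finrank K (ℬ i) ≤ finrank K (ℬ i₀)) :
    IsGreatest {d : ℕ | ∃ I : Ideal A, nu K (Ideal.span {x | ∃ i ≥ 1, x ∈ ℬ i}) I = d}
      (finrank K (ℬ i₀)) := by
  set m : Ideal A := Ideal.span {x | ∃ i ≥ 1, x ∈ ℬ i} with hm
  have upper : ∀ I : Ideal A, nu K m I ≤ finrank K (ℬ i₀) := by
    intro I
    have hle := restrictScalars_mul_le (K := K) m I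
    have h1 := nu_add_finrank (K := K) m I
    rw [finrank_eq_sum_leadingForms ℬ hN, finrank_eq_sum_leadingForms ℬ hN] at h1
    have h2 := sum_sub_le_of_normalized_matching
      (x := fun d => finrank K (leadingForms ℬ (I.restrictScalars K) d))
      (y := fun d => finrank K (leadingForms ℬ ((m * I).restrictScalars K) d))
      (H := fun d => finrank K (ℬ d)) (M := finrank K (ℬ i₀))
      (fun d => by exact_mod_cast Submodule.finrank_mono (leadingForms_le ℬ _ d))
      (fun d => Nat.cast_nonneg _)
      (fun d => by exact_mod_cast Submodule.finrank_mono (leadingForms_mono ℬ hle d))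
      (fun d => by exact_mod_cast hi₀ d) (fun d hd => by exact_mod_cast h0 d (by exact_mod_cast hd))
      (fun d => by
        have h3 := hNM d _ (leadingForms_le ℬ (I.restrictScalars K) d)
        have h4 := Submodule.finrank_mono (mul_leadingForms_le ℬ (m := m) (I := I)
          (fun a ha => Ideal.subset_span ⟨1, le_rfl, ha⟩) d)
        exact_mod_cast h3.trans (Nat.mul_le_mul_right _ h4)) N
    rw [Finset.sum_sub_distrib] at h2
    have h5 : (nu K m I : ℝ) + ∑ d ∈ Finset.range N,
        (finrank K (leadingForms ℬ ((m * I).restrictScalars K) d) : ℝ) = ∑ d ∈ Finset.range N,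
        (finrank K (leadingForms ℬ (I.restrictScalars K) d) : ℝ) := by exact_mod_cast h1
    have h6 : (nu K m I : ℝ) ≤ finrank K (ℬ i₀) := by linarith
    exact_mod_cast h6
  refine ⟨⟨Ideal.span (ℬ i₀ : Set A), le_antisymm (upper _) ?_⟩, ?_⟩
  · set I : Ideal A := Ideal.span (ℬ i₀ : Set A)
    have h1 := nu_add_finrank (K := K) m I
    have h2 := finrank_map_add_finrank_inf_ker (GradedAlgebra.proj ℬ i₀) (I.restrictScalars K)
    have h3 : ℬ i₀ ≤ (I.restrictScalars K).map (GradedAlgebra.proj ℬ i₀) := fun x hx =>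
      ⟨x, Ideal.subset_span hx, by
        rw [GradedAlgebra.proj_apply, DirectSum.decompose_of_mem_same ℬ hx]⟩
    have h4 : (m * I).restrictScalars K ≤
        I.restrictScalars K ⊓ LinearMap.ker (GradedAlgebra.proj ℬ i₀) := by
      intro x hx
      refine ⟨restrictScalars_mul_le m I hx, ?_⟩
      rw [Submodule.restrictScalars_mem, Ideal.span_mul_span'] at hx
      have key : ∀ a : A, (DirectSum.decompose ℬ (a * x) i₀ : A) = 0 := by
        induction hx using Submodule.span_induction with
        | mem x hx =>
          obtain ⟨c, ⟨i, hi, hc⟩, y, hy, rfl⟩ := hx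
          exact fun a => DirectSum.coe_decompose_mul_of_right_mem_of_not_le ℬ
            (SetLike.mul_mem_graded hc hy) (by omega)
        | zero => simp
        | add x y _ _ hx hy =>
          intro a
          rw [mul_add, DirectSum.decompose_add, DirectSum.add_apply, Submodule.coe_add, hx, hy,
            add_zero]
        | smul b x _ hx =>
          intro a
          rw [smul_eq_mul, ← mul_assoc, hx]
      rw [SetLike.mem_coe, LinearMap.mem_ker, GradedAlgebra.proj_apply, ← one_mul x, key]
    have h5 := Submodule.finrank_mono h3
    have h6 := Submodule.finrank_mono h4
    omega
  · rintro _ ⟨I, rfl⟩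
    exact upper I

end Sperner

section QuotientGrading

variable {K : Type*} [Field K] {n : ℕ} {b : Ideal (MvPolynomial (Fin n) K)}

lemma homogeneousComponent_mem_span {s : Set (MvPolynomial (Fin n) K)}
    (hs : ∀ p ∈ s, ∃ d, p.IsHomogeneous d) {p : MvPolynomial (Fin n) K} (hp : p ∈ Ideal.span s)
    (i : ℕ) : homogeneousComponent i p ∈ Ideal.span s := by
  let := MvPolynomial.gradedAlgebra (R := K) (σ := Fin n)
  exact homogeneousComponent_mem_of_mem (Ideal.homogeneous_span _ _ hs) hp i

lemma mem_gradedPiece {i : ℕ} {x : MvPolynomial (Fin n) K ⧸ b} :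
    x ∈ gradedPiece b i ↔ ∃ p : MvPolynomial (Fin n) K, p.IsHomogeneous i ∧
      Ideal.Quotient.mk b p = x :=
  Iff.rfl

instance (i : ℕ) : FiniteDimensional K (gradedPiece b i) := by
  have : FiniteDimensional K (homogeneousSubmodule (Fin n) K i) :=
    Module.Finite.iff_fg.2 (homogeneousSubmodule_fg (Fin n) K i)
  unfold gradedPiece
  infer_instance

instance : SetLike.GradedMonoid (gradedPiece b) where
  one_mem := ⟨1, isHomogeneous_one _ _, map_one (Ideal.Quotient.mk b)⟩
  mul_mem := by
    rintro i j _ _ ⟨p, hp, rfl⟩ ⟨q, hq, rfl⟩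
    exact ⟨p * q, IsHomogeneous.mul hp hq, map_mul (Ideal.Quotient.mk b) p q⟩

lemma isInternal_gradedPiece (hb : ∀ p ∈ b, ∀ i, homogeneousComponent i p ∈ b) :
    DirectSum.IsInternal (gradedPiece b) := by
  classical
  constructor
  · rw [injective_iff_map_eq_zero]
    intro z hz
    choose p hp hpz using fun i => mem_gradedPiece.1 (z i).2
    rw [DirectSum.coeAddMonoidHom_eq_dfinsuppSum, DFinsupp.sum] at hz
    have hsum : ∑ i ∈ z.support, p i ∈ b := by
      rw [← Ideal.Quotient.eq_zero_iff_mem, map_sum, ← hz]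
      exact Finset.sum_congr rfl fun i _ => hpz i
    ext i
    by_cases hi : i ∈ z.support
    · have h := hb _ hsum i
      rw [map_sum, Finset.sum_eq_single i (fun j _ hj => ?_) (fun h => absurd hi h),
        homogeneousComponent_of_mem (hp i), if_pos rfl] at h
      · rw [← hpz i, Ideal.Quotient.eq_zero_iff_mem.2 h]
        rfl
      · rw [homogeneousComponent_of_mem (hp j), if_neg hj.symm]
    · rw [DFinsupp.notMem_support_iff.1 hi]
      rfl
  · intro x
    obtain ⟨p, rfl⟩ := Ideal.Quotient.mk_surjective x
    refine ⟨∑ i ∈ Finset.range (p.totalDegree + 1), DirectSum.of (fun i => gradedPiece b i) i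
      ⟨_, _, homogeneousComponent_isHomogeneous i p, rfl⟩, ?_⟩
    rw [map_sum]
    conv_rhs => rw [← sum_homogeneousComponent p, map_sum]
    exact Finset.sum_congr rfl fun i _ => DirectSum.coeAddMonoidHom_of _ _ _

/-- The standard grading of the quotient of the polynomial ring by a homogeneous ideal. -/
noncomputable abbrev gradedPieceGradedAlgebra
    (hb : ∀ p ∈ b, ∀ i, homogeneousComponent i p ∈ b) : GradedAlgebra (gradedPiece b) :=
  { (isInternal_gradedPiece hb).chooseDecomposition with }

lemma finrank_gradedPiece (i : ℕ) : finrank K (gradedPiece b i) = quotDim b (intPiece K n i) := by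
  rw [intPiece_natCast]
  rfl

lemma finrank_mul_le_of_hasNormalizedMatching (h : HasNormalizedMatching (intPiece K n) b) {d : ℕ}
    {V : Submodule K (MvPolynomial (Fin n) K ⧸ b)} (hV : V ≤ gradedPiece b d) :
    finrank K V * finrank K (gradedPiece b (d + 1)) ≤
      finrank K (gradedPiece b 1 * V : Submodule K (MvPolynomial (Fin n) K ⧸ b)) *
        finrank K (gradedPiece b d) := by
  set φ := (Ideal.Quotient.mkₐ K b).toLinearMap with hφ
  have hW : (intPiece K n d ⊓ V.comap φ).map φ = V := by
    rw [← Submodule.map_inf_eq_map_inf_comap, intPiece_natCast]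
    exact inf_eq_right.2 hV
  have h1 := h d (intPiece K n d ⊓ V.comap φ) inf_le_left
  have h2 : (intPiece K n 1 * (intPiece K n d ⊓ V.comap φ)).map φ = gradedPiece b 1 * V := by
    rw [hφ, Submodule.map_mul, ← hφ, hW, intPiece_one]
    rfl
  rw [finrank_gradedPiece, finrank_gradedPiece, ← h2]
  have h3 : finrank K V = quotDim b (intPiece K n d ⊓ V.comap φ) := by
    rw [quotDim, ← hφ, hW]
  rw [h3]
  exact_mod_cast h1

lemma finiteDimensional_of_gradedPiece_eq_bot [GradedAlgebra (gradedPiece b)] {N : ℕ}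
    (hN : ∀ d ≥ N, gradedPiece b d = ⊥) : FiniteDimensional K (MvPolynomial (Fin n) K ⧸ b) := by
  have h : (⊤ : Submodule K (MvPolynomial (Fin n) K ⧸ b)) =
      (Finset.range N).sup (gradedPiece b) := by
    refine (eq_top_iff.2 fun x _ => ?_).symm
    rw [eq_sum_decompose (gradedPiece b) hN x]
    exact Submodule.sum_mem _ fun i hi => Finset.le_sup (f := gradedPiece b) hi (SetLike.coe_mem _)
  have h2 : FiniteDimensional K (⊤ : Submodule K (MvPolynomial (Fin n) K ⧸ b)) := by
    rw [h]
    exact Submodule.finiteDimensional_finset_sup _ _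
  exact Module.finite_def.2 (Module.Finite.iff_fg.1 h2)

end QuotientGrading

/-- **Sperner property of complete intersections with `n − 2` generators split into linear
forms.**  Let `K` be algebraically closed, `n ≥ 2`, and let `f_1,…,f_n` be a homogeneous
regular sequence of positive degrees in `R = K[x_1,…,x_n]` in which at least `n − 2` of the
`f_j` are products of linear forms.  Then `A = R/(f_1,…,f_n)` has the Sperner property: the
maximum of `μ(I)` over all ideals `I ⊆ A` is `max_i dim_K A_i`. -/
theorem sperner_of_ci_allButTwo_products_of_linear_forms
    {K : Type*} [Field K] [IsAlgClosed K] {n : ℕ} (hn : 2 ≤ n)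
    (f : Fin n → MvPolynomial (Fin n) K)
    (hhom : ∀ j, ∃ d : ℕ, 0 < d ∧ (f j).IsHomogeneous d)
    (S : Finset (Fin n)) (hScard : n - 2 ≤ S.card)
    (hlin : ∀ j ∈ S, IsProductOfLinearForms (f j))
    (hreg : RingTheory.Sequence.IsRegular (MvPolynomial (Fin n) K) (List.ofFn f)) :
    ∃ i₀ : ℕ,
      (∀ i : ℕ, finrank K (gradedPiece (Ideal.span (Set.range f)) i) ≤
        finrank K (gradedPiece (Ideal.span (Set.range f)) i₀)) ∧
      IsGreatest
        {d : ℕ | ∃ I : Ideal (MvPolynomial (Fin n) K ⧸ Ideal.span (Set.range f)),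
          nu K (gradedMaxIdeal (Ideal.span (Set.range f))) I = d}
        (finrank K (gradedPiece (Ideal.span (Set.range f)) i₀)) := by
  choose D hD hf using hhom
  set b := Ideal.span (Set.range f)
  have hb : ∀ p ∈ b, ∀ i, homogeneousComponent i p ∈ b := fun p hp =>
    homogeneousComponent_mem_span (Set.forall_mem_range.2 fun j => ⟨D j, hf j⟩) hp
  obtain ⟨h, hh, key⟩ := LinearizedSystem.exists_hilbertFunction (K := K) hD hScard _ ∅ rfl
  obtain ⟨hdim, hNM⟩ := key f (linearizedSystem_empty hD hf hlin hreg.toIsWeaklyRegular)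
  have hdim' (d : ℕ) : (finrank K (gradedPiece b d) : ℝ) = h d := by
    rw [finrank_gradedPiece]
    exact hdim d
  obtain ⟨N, hN⟩ := hh.eventually_zero
  have hbot (d : ℕ) (hd : d ≥ N.toNat) : gradedPiece b d = ⊥ := by
    refine Submodule.finrank_eq_zero.1 ?_
    exact_mod_cast (hdim' d).trans (hN d (by omega))
  let := gradedPieceGradedAlgebra hb
  have := finiteDimensional_of_gradedPiece_eq_bot hbot
  obtain ⟨i₀, -, hi₀⟩ := Finset.exists_max_image (Finset.range (N.toNat + 1))
    (fun i => finrank K (gradedPiece b i)) Finset.nonempty_range_add_one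
  have hmax (i : ℕ) : finrank K (gradedPiece b i) ≤ finrank K (gradedPiece b i₀) := by
    rcases lt_or_ge i (N.toNat + 1) with hi | hi
    · exact hi₀ i (Finset.mem_range.2 hi)
    · rw [hbot i (by omega), finrank_bot]
      exact Nat.zero_le _
  refine ⟨i₀, hmax, isGreatest_nu_of_normalized_matching (gradedPiece b) hbot
    (fun d V hV => finrank_mul_le_of_hasNormalizedMatching hNM hV) (fun d hd => ?_) hmax⟩
  have h1 : h d = 0 := by rw [← hdim' d, hd, Nat.cast_zero]
  have h2 := StronglyLogConcave.eq_zero_succ hh.logConcave hh.nonneg hh.pos_zero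
    (Int.natCast_nonneg d) h1
  have h3 := hdim' (d + 1)
  rw [Nat.cast_succ, h2] at h3
  exact_mod_cast h3
end

section
/- Let K be a field, R = K[x_1,...,x_n], and B = R/(x_1^{a_1},...,x_n^{a_n}) with a_1,...,a_n positive integers, a monomial complete intersection with its standard grading B = ⊕_{i=0}^c B_i. Then B has the matching property: for every j with dim_K B_j ≤ dim_K B_{j+1} and every K-vector subspace V ⊆ B_j, one has dim_K V ≤ dim_K (B_1 · V), where B_1 · V is the K-span of {xv : x ∈ B_1, v ∈ V}. -/
open MvPolynomial Module

/-- For subspaces `W, V` of a `K`-algebra `A`, the `K`-span of `{x * v : x ∈ W, v ∈ V}`. -/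
noncomputable def mulSpan {K A : Type*} [Field K] [CommRing A] [Algebra K A]
    (W V : Submodule K A) : Submodule K A :=
  Submodule.span K {z | ∃ x ∈ W, ∃ v ∈ V, z = x * v}

/-- An `sl₂`-crystal structure on the product of chains `∏ i, {0, …, a i - 1}`: partially defined
mutually inverse raising and lowering operators `f` and `e`, which move along covering relations,
together with the number of times `φ`, `ε` each of them can be applied. -/
structure IsBoxCrystal {n : ℕ} (a : Fin n → ℕ) (ε φ : (Fin n → ℕ) → ℕ)
    (f e : (Fin n → ℕ) → Fin n → ℕ) : Prop where
  weight : ∀ x, (∀ i, x i < a i) → φ x + 2 * ∑ i, x i + n = ε x + ∑ i, a i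
  raise_mem : ∀ x, (∀ i, x i < a i) → 0 < φ x → ∀ i, f x i < a i
  raise_cover : ∀ x, (∀ i, x i < a i) → 0 < φ x → ∃ i, f x = x + Pi.single i 1
  ε_raise : ∀ x, (∀ i, x i < a i) → 0 < φ x → ε (f x) = ε x + 1
  φ_raise : ∀ x, (∀ i, x i < a i) → 0 < φ x → φ (f x) + 1 = φ x
  lower_raise : ∀ x, (∀ i, x i < a i) → 0 < φ x → e (f x) = x
  lower_mem : ∀ x, (∀ i, x i < a i) → 0 < ε x → ∀ i, e x i < a i
  lower_cover : ∀ x, (∀ i, x i < a i) → 0 < ε x → ∃ i, x = e x + Pi.single i 1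
  ε_lower : ∀ x, (∀ i, x i < a i) → 0 < ε x → ε (e x) + 1 = ε x
  φ_lower : ∀ x, (∀ i, x i < a i) → 0 < ε x → φ (e x) = φ x + 1
  raise_lower : ∀ x, (∀ i, x i < a i) → 0 < ε x → f (e x) = x

theorem Fin.cons_add_single_succ {n : ℕ} (x : ℕ) (y : Fin n → ℕ) (i : Fin n) :
    (Fin.cons x (y + Pi.single i 1) : Fin (n + 1) → ℕ) = Fin.cons x y + Pi.single i.succ 1 := by
  ext k
  refine Fin.cases ?_ (fun k => ?_) k
  · simp
  · simp [Pi.single_apply]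

theorem Fin.cons_add_single_zero {n : ℕ} (x : ℕ) (y : Fin n → ℕ) :
    (Fin.cons (x + 1) y : Fin (n + 1) → ℕ) = Fin.cons x y + Pi.single 0 1 := by
  ext k
  refine Fin.cases ?_ (fun k => ?_) k
  · simp
  · simp

/-- The tensor product rule for crystals: a crystal on a product of chains extends to a crystal
on the product with one more chain. -/
theorem IsBoxCrystal.cons {n : ℕ} {a : Fin (n + 1) → ℕ}
    {ε φ : (Fin n → ℕ) → ℕ} {f e : (Fin n → ℕ) → Fin n → ℕ}
    (h : IsBoxCrystal (fun i => a i.succ) ε φ f e) :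
    IsBoxCrystal a
      (fun x => x 0 + (ε (Fin.tail x) - (a 0 - 1 - x 0)))
      (fun x => φ (Fin.tail x) + (a 0 - 1 - x 0 - ε (Fin.tail x)))
      (fun x => if ε (Fin.tail x) < a 0 - 1 - x 0 then Fin.cons (x 0 + 1) (Fin.tail x)
        else Fin.cons (x 0) (f (Fin.tail x)))
      (fun x => if a 0 - 1 - x 0 < ε (Fin.tail x) then Fin.cons (x 0) (e (Fin.tail x))
        else Fin.cons (x 0 - 1) (Fin.tail x)) := by
  have box : ∀ x : Fin (n + 1) → ℕ, (∀ i, x i < a i) ↔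
      x 0 < a 0 ∧ ∀ i, Fin.tail x i < a i.succ := fun x => Fin.forall_fin_succ
  have eta : ∀ x : Fin (n + 1) → ℕ, Fin.cons (x 0) (Fin.tail x) = x := Fin.cons_self_tail
  constructor <;> intro x hx <;> obtain ⟨h0, ht⟩ := (box x).1 hx
  · have := h.weight _ ht
    simp only [Fin.sum_univ_succ, Fin.tail] at this ⊢
    omega
  all_goals intro hpos
  · have := h.raise_mem _ ht
    rw [box]
    split_ifs
    · simpa using ⟨by omega, ht⟩
    · simpa using ⟨h0, this (by omega)⟩
  · have := h.raise_cover _ ht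
    split_ifs
    · exact ⟨0, by rw [Fin.cons_add_single_zero, eta]⟩
    · obtain ⟨i, hi⟩ := this (by omega)
      exact ⟨i.succ, by rw [hi, Fin.cons_add_single_succ, eta]⟩
  · have := h.ε_raise _ ht
    split_ifs
    · simp only [Fin.cons_zero, Fin.tail_cons]; omega
    · simp only [Fin.cons_zero, Fin.tail_cons]; omega
  · have h1 := h.ε_raise _ ht
    have h2 := h.φ_raise _ ht
    split_ifs
    · simp only [Fin.cons_zero, Fin.tail_cons]; omega
    · simp only [Fin.cons_zero, Fin.tail_cons]; omega
  · have h1 := h.ε_raise _ ht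
    have h2 := h.lower_raise _ ht
    by_cases hc : ε (Fin.tail x) < a 0 - 1 - x 0
    · simp only [if_pos hc, Fin.cons_zero, Fin.tail_cons]
      rw [if_neg (by omega), Nat.add_sub_cancel, eta]
    · simp only [if_neg hc, Fin.cons_zero, Fin.tail_cons]
      rw [if_pos (by omega), h2 (by omega), eta]
  · have := h.lower_mem _ ht
    rw [box]
    split_ifs
    · simpa using ⟨h0, this (by omega)⟩
    · simpa using ⟨by omega, ht⟩
  · have := h.lower_cover _ ht
    split_ifs
    · obtain ⟨i, hi⟩ := this (by omega)
      exact ⟨i.succ, by rw [← Fin.cons_add_single_succ, ← hi, eta]⟩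
    · exact ⟨0, by rw [← Fin.cons_add_single_zero, Nat.sub_add_cancel (by omega), eta]⟩
  · have := h.ε_lower _ ht
    split_ifs
    · simp only [Fin.cons_zero, Fin.tail_cons]; omega
    · simp only [Fin.cons_zero, Fin.tail_cons]; omega
  · have h1 := h.ε_lower _ ht
    have h2 := h.φ_lower _ ht
    split_ifs
    · simp only [Fin.cons_zero, Fin.tail_cons]; omega
    · simp only [Fin.cons_zero, Fin.tail_cons]; omega
  · have h1 := h.ε_lower _ ht
    have h2 := h.raise_lower _ ht
    by_cases hc : a 0 - 1 - x 0 < ε (Fin.tail x)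
    · simp only [if_pos hc, Fin.cons_zero, Fin.tail_cons]
      rw [if_neg (by omega), h2 (by omega), eta]
    · simp only [if_neg hc, Fin.cons_zero, Fin.tail_cons]
      rw [if_pos (by omega), Nat.sub_add_cancel (by omega), eta]

theorem exists_isBoxCrystal : ∀ {n : ℕ} (a : Fin n → ℕ), ∃ ε φ f e, IsBoxCrystal a ε φ f e
  | 0, a => ⟨0, 0, id, id, by constructor <;> simp⟩
  | n + 1, a => by
    obtain ⟨ε, φ, f, e, h⟩ := exists_isBoxCrystal fun i : Fin n => a i.succ
    exact ⟨_, _, _, _, h.cons⟩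

/-- The elements of rank `j` in the product of chains `∏ i, {0, …, a i - 1}`. -/
def boxLevel {n : ℕ} (a : Fin n → ℕ) (j : ℕ) : Finset (Fin n → ℕ) :=
  {x ∈ Fintype.piFinset fun i => Finset.range (a i) | ∑ i, x i = j}

theorem mem_boxLevel {n : ℕ} {a : Fin n → ℕ} {j : ℕ} {x : Fin n → ℕ} :
    x ∈ boxLevel a j ↔ (∀ i, x i < a i) ∧ ∑ i, x i = j := by
  simp [boxLevel]

theorem sum_add_single {n : ℕ} (x : Fin n → ℕ) (i : Fin n) :
    ∑ k, (x + Pi.single i 1 : Fin n → ℕ) k = ∑ k, x k + 1 := by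
  simp [Finset.sum_add_distrib]

/-- Consecutive levels of a product of chains admit a full matching from the lower level into
the upper one as soon as the lower one is not larger. -/
theorem exists_matching_boxLevel {n : ℕ} (a : Fin n → ℕ) (j : ℕ)
    (hj : (boxLevel a j).card ≤ (boxLevel a (j + 1)).card) :
    ∃ g : (Fin n → ℕ) → Fin n → ℕ, Set.InjOn g (boxLevel a j) ∧
      ∀ x ∈ boxLevel a j, (∀ i, g x i < a i) ∧ ∃ i, g x = x + Pi.single i 1 := by
  obtain ⟨ε, φ, f, e, h⟩ := exists_isBoxCrystal a
  by_cases hc : 2 * j + n < ∑ i, a i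
  · have hφ : ∀ x ∈ boxLevel a j, (∀ i, x i < a i) ∧ 0 < φ x := fun x hx => by
      obtain ⟨hx, hs⟩ := mem_boxLevel.1 hx
      have := h.weight x hx
      exact ⟨hx, by omega⟩
    refine ⟨f, fun x hx y hy hxy => ?_, fun x hx => ?_⟩
    · obtain ⟨hx, hx'⟩ := hφ x hx
      obtain ⟨hy, hy'⟩ := hφ y hy
      rw [← h.lower_raise x hx hx', hxy, h.lower_raise y hy hy']
    · obtain ⟨hx, hx'⟩ := hφ x hx
      exact ⟨h.raise_mem x hx hx', h.raise_cover x hx hx'⟩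
  · have hε : ∀ x ∈ boxLevel a (j + 1), (∀ i, x i < a i) ∧ 0 < ε x := fun x hx => by
      obtain ⟨hx, hs⟩ := mem_boxLevel.1 hx
      have := h.weight x hx
      exact ⟨hx, by omega⟩
    have hmaps : Set.MapsTo e (boxLevel a (j + 1)) (boxLevel a j) := fun x hx => by
      have hs := (mem_boxLevel.1 hx).2
      obtain ⟨hx, hx'⟩ := hε x hx
      obtain ⟨i, hi⟩ := h.lower_cover x hx hx'
      refine mem_boxLevel.2 ⟨h.lower_mem x hx hx', ?_⟩
      have := sum_add_single (e x) i
      rw [← hi] at this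
      omega
    have hinj : Set.InjOn e (boxLevel a (j + 1)) := fun x hx y hy hxy => by
      obtain ⟨hx, hx'⟩ := hε x hx
      obtain ⟨hy, hy'⟩ := hε y hy
      rw [← h.raise_lower x hx hx', hxy, h.raise_lower y hy hy']
    have hsurj := Finset.surjOn_of_injOn_of_card_le e hmaps hinj hj
    have key : ∀ x ∈ boxLevel a j, ∃ y ∈ boxLevel a (j + 1), e y = x := fun x hx => hsurj hx
    choose! g hg hge using key
    refine ⟨g, fun x hx y hy hxy => ?_, fun x hx => ?_⟩
    · rw [← hge x hx, hxy, hge y hy]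
    · obtain ⟨hy, hy'⟩ := hε _ (hg x hx)
      have := h.lower_cover _ hy hy'
      rw [hge x hx] at this
      exact ⟨hy, this⟩

theorem Submodule.finrank_le_card_of_separating {K M ι : Type*} [Field K] [AddCommGroup M]
    [Module K M] (V : Submodule K M) (c : ι → M →ₗ[K] K) (S : Finset ι)
    (h : ∀ v ∈ V, (∀ i ∈ S, c i v = 0) → v = 0) : finrank K V ≤ S.card := by
  let r : V →ₗ[K] (S → K) := LinearMap.pi fun i => (c i).comp V.subtype
  have hr : Function.Injective r := by
    rw [← LinearMap.ker_eq_bot, LinearMap.ker_eq_bot']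
    intro v hv
    exact Subtype.ext (h v v.2 fun i hi => congrFun hv ⟨i, hi⟩)
  simpa using LinearMap.finrank_le_finrank_of_injective hr

/-- A family which is triangular with respect to a family of linear functionals gives a lower
bound for the dimension of any subspace containing it. -/
theorem Submodule.card_le_finrank_of_triangular {K M κ Λ : Type*} [Field K] [AddCommGroup M]
    [Module K M] [LinearOrder Λ] (W : Submodule K M) [FiniteDimensional K W] (S : Finset κ)
    (w : κ → M) (u : κ → M →ₗ[K] K) (o : κ → Λ) (ho : Set.InjOn o S)
    (hW : ∀ s ∈ S, w s ∈ W) (hdiag : ∀ s ∈ S, u s (w s) ≠ 0)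
    (htri : ∀ s ∈ S, ∀ t ∈ S, o s < o t → u t (w s) = 0) : S.card ≤ finrank K W := by
  have hli : LinearIndependent K fun s : S => (⟨w s, hW s s.2⟩ : W) := by
    classical
    rw [Fintype.linearIndependent_iff]
    intro g hg
    by_contra! hne
    obtain ⟨i₀, hi₀⟩ := hne
    obtain ⟨t, ht, hmax⟩ := Finset.exists_max_image
      (Finset.univ.filter fun s : S => g s ≠ 0) (fun s => o s) ⟨i₀, by simpa using hi₀⟩
    have hgt : g t ≠ 0 := by simpa using ht
    have h0 := congrArg (fun v : W => u t v) hg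
    simp only [Submodule.coe_sum, Submodule.coe_smul, map_sum, map_smul, smul_eq_mul,
      Submodule.coe_zero, map_zero] at h0
    rw [Finset.sum_eq_single t] at h0
    · exact mul_ne_zero hgt (hdiag t t.2) h0
    · intro s _ hst
      by_cases hgs : g s = 0
      · simp [hgs]
      · have hle := hmax s (by simpa using hgs)
        have hlt := lt_of_le_of_ne hle fun heq => hst (Subtype.ext (ho s.2 t.2 heq))
        rw [htri s s.2 t t.2 hlt, mul_zero]
    · simp
  simpa using hli.fintype_card_le_finrank

section Coefficients

variable {K : Type*} [Field K] {n : ℕ} (a : Fin n → ℕ)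

theorem mem_span_X_pow_iff (p : MvPolynomial (Fin n) K) :
    p ∈ Ideal.span (Set.range fun i : Fin n => (X i : MvPolynomial (Fin n) K) ^ a i) ↔
      ∀ m : Fin n →₀ ℕ, (∀ i, m i < a i) → coeff m p = 0 := by
  have : (Set.range fun i : Fin n => (X i : MvPolynomial (Fin n) K) ^ a i) =
      (fun s => monomial s (1 : K)) '' Set.range fun i => Finsupp.single i (a i) := by
    rw [← Set.range_comp]
    simp [Function.comp_def, X_pow_eq_monomial]
  rw [this, mem_ideal_span_monomial_image]
  refine forall_congr' fun m => ?_
  simp only [Set.exists_range_iff, Finsupp.single_le_iff, MvPolynomial.mem_support_iff]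
  constructor
  · intro h hm
    by_contra hne
    obtain ⟨i, hi⟩ := h hne
    exact absurd (hm i) (by omega)
  · intro h hne
    by_contra! hm
    exact hne (h hm)

/-- The coefficient of a monomial as a functional on a monomial complete intersection; it is zero
for the monomials in the defining ideal. -/
theorem exists_quotient_coeff (b : Ideal (MvPolynomial (Fin n) K))
    (hb : b = Ideal.span (Set.range fun i : Fin n => (X i : MvPolynomial (Fin n) K) ^ a i)) :
    ∃ c : (Fin n →₀ ℕ) → (MvPolynomial (Fin n) K ⧸ b) →ₗ[K] K,
      ∀ m p, ((∀ i, m i < a i) → c m (Ideal.Quotient.mk _ p) = coeff m p) ∧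
        ((¬ ∀ i, m i < a i) → c m (Ideal.Quotient.mk _ p) = 0) := by
  classical
  let F : (Fin n →₀ ℕ) → MvPolynomial (Fin n) K →ₗ[K] K :=
    fun m => if ∀ i, m i < a i then lcoeff K m else 0
  have hF : ∀ m, b.restrictScalars K ≤ LinearMap.ker (F m) := by
    intro m p hp
    rw [Submodule.restrictScalars_mem, hb, mem_span_X_pow_iff] at hp
    rw [LinearMap.mem_ker]
    by_cases h : ∀ i, m i < a i
    · simpa [F, if_pos h] using hp m h
    · simp [F, if_neg h]
  refine ⟨fun m => ((b.restrictScalars K).liftQ (F m) (hF m)).comp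
    (Submodule.Quotient.restrictScalarsEquiv K b).symm.toLinearMap, fun m p => ?_⟩
  have key : ((b.restrictScalars K).liftQ (F m) (hF m)).comp
      (Submodule.Quotient.restrictScalarsEquiv K b).symm.toLinearMap
        (Ideal.Quotient.mk b p) = F m p := rfl
  rw [key]
  exact ⟨fun h => by simp [F, if_pos h], fun h => by simp [F, if_neg h]⟩

end Coefficients

/-- **Matching property of monomial complete intersections.** Let
`B = K[x_1,…,x_n]/(x_1^{a_1},…,x_n^{a_n})`. For every `j` with
`dim_K B_j ≤ dim_K B_{j+1}` and every subspace `V ⊆ B_j`, one has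
`dim_K V ≤ dim_K (B_1 · V)`. -/
theorem monomial_complete_intersection_matching
    {K : Type*} [Field K] {n : ℕ} (a : Fin n → ℕ) (ha : ∀ i, 0 < a i)
    (b : Ideal (MvPolynomial (Fin n) K))
    (hb : b = Ideal.span (Set.range fun i : Fin n => (X i : MvPolynomial (Fin n) K) ^ a i))
    (j : ℕ)
    (hj : finrank K (gradedPiece b j) ≤ finrank K (gradedPiece b (j + 1)))
    (V : Submodule K (MvPolynomial (Fin n) K ⧸ b)) (hV : V ≤ gradedPiece b j) :
    finrank K V ≤ finrank K (mulSpan (gradedPiece b 1) V) := by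
  classical
  obtain ⟨c, hc⟩ := exists_quotient_coeff a b hb
  have c_box : ∀ m : Fin n →₀ ℕ, (∀ i, m i < a i) → ∀ p,
      c m (Ideal.Quotient.mk b p) = coeff m p := fun m hm p => (hc m p).1 hm
  let τ : (Fin n → ℕ) → (Fin n →₀ ℕ) := Finsupp.equivFunOnFinite.symm
  have τ_inj : Function.Injective τ := Finsupp.equivFunOnFinite.symm.injective
  have τ_coe : ∀ m : Fin n →₀ ℕ, τ m = m := Finsupp.equivFunOnFinite.symm_apply_apply
  have τ_apply : ∀ x i, τ x i = x i := fun x i => rfl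
  have eq_zero : ∀ v, (∀ m : Fin n →₀ ℕ, (∀ i, m i < a i) → c m v = 0) → v = 0 := by
    intro v hv
    obtain ⟨p, rfl⟩ := Ideal.Quotient.mk_surjective v
    rw [Ideal.Quotient.eq_zero_iff_mem, hb, mem_span_X_pow_iff]
    intro m hm
    rw [← c_box m hm]
    exact hv m hm
  have c_graded : ∀ k, ∀ v ∈ gradedPiece b k, ∀ m : Fin n →₀ ℕ, ∑ i, m i ≠ k → c m v = 0 := by
    rintro k _ ⟨p, hp, rfl⟩ m hm
    by_cases hbox : ∀ i, m i < a i
    · refine (c_box m hbox p).trans ?_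
      refine IsHomogeneous.coeff_eq_zero ((mem_homogeneousSubmodule _ _).1 hp) ?_
      rwa [Finsupp.degree_eq_sum]
    · exact (hc m p).2 hbox
  have graded_sep : ∀ k, ∀ v ∈ gradedPiece b k, (∀ x ∈ boxLevel a k, c (τ x) v = 0) → v = 0 := by
    intro k v hv h
    refine eq_zero v fun m hm => ?_
    by_cases hs : ∑ i, m i = k
    · have := h m (mem_boxLevel.2 ⟨hm, hs⟩)
      rwa [τ_coe] at this
    · exact c_graded k v hv m hs
  have hfin : FiniteDimensional K (MvPolynomial (Fin n) K ⧸ b) := by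
    let S := Fintype.piFinset fun i => Finset.range (a i)
    let r : (MvPolynomial (Fin n) K ⧸ b) →ₗ[K] (S → K) := LinearMap.pi fun x => c (τ x)
    refine FiniteDimensional.of_injective r ?_
    rw [← LinearMap.ker_eq_bot, LinearMap.ker_eq_bot']
    intro v hv
    refine eq_zero v fun m hm => ?_
    have := congrFun hv ⟨m, by simpa [S] using hm⟩
    rwa [show r v ⟨m, _⟩ = c (τ m) v from rfl,
      τ_coe] at this
  have card_le : (boxLevel a j).card ≤ (boxLevel a (j + 1)).card := by
    refine le_trans ?_ (hj.trans (Submodule.finrank_le_card_of_separating _ (fun x => c (τ x)) _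
      (graded_sep (j + 1))))
    refine Submodule.card_le_finrank_of_triangular _ _
      (fun x => Ideal.Quotient.mk b (monomial (τ x) 1)) (fun x => c (τ x)) (fun x => toLex (τ x))
      (fun x _ y _ h => τ_inj h) (fun x hx => ?_) (fun x hx => ?_) (fun x _ y hy h => ?_)
    · refine ⟨monomial (τ x) 1, ?_, rfl⟩
      refine (mem_homogeneousSubmodule _ _).2 (isHomogeneous_monomial _ ?_)
      rw [Finsupp.degree_eq_sum]
      exact (mem_boxLevel.1 hx).2
    · simp [c_box (τ x) (mem_boxLevel.1 hx).1]
    · rw [c_box (τ y) (mem_boxLevel.1 hy).1, coeff_monomial, if_neg]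
      exact fun heq => h.ne (congrArg toLex heq)
  obtain ⟨g, g_inj, hg⟩ := exists_matching_boxLevel a j card_le
  let S := (boxLevel a j).filter fun x =>
    ∃ v ∈ V, c (τ x) v ≠ 0 ∧ ∀ m : Fin n →₀ ℕ, toLex (τ x) < toLex m → c m v = 0
  have hVS : finrank K V ≤ S.card := by
    refine Submodule.finrank_le_card_of_separating _ (fun x => c (τ x)) _ fun v hv hS => ?_
    refine graded_sep j v (hV hv) ?_
    by_contra! hne
    obtain ⟨x₀, hx₀, hx₀'⟩ := hne
    obtain ⟨x, hx, hmax⟩ := Finset.exists_max_image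
      ((boxLevel a j).filter fun x => c (τ x) v ≠ 0) (fun x => toLex (τ x))
      ⟨x₀, by simp [hx₀, hx₀']⟩
    obtain ⟨hxl, hxv⟩ := Finset.mem_filter.1 hx
    refine hxv (hS x (Finset.mem_filter.2 ⟨hxl, v, hv, hxv, fun m hm => ?_⟩))
    by_contra hmv
    by_cases hbox : (∀ i, m i < a i)
    · have hs : ∑ i, m i = j := by
        by_contra hs
        exact hmv (c_graded j v (hV hv) m hs)
      have := hmax m (Finset.mem_filter.2 ⟨mem_boxLevel.2 ⟨hbox, hs⟩, by
        rwa [τ_coe]⟩)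
      rw [τ_coe] at this
      exact absurd hm (not_lt.2 this)
    · obtain ⟨p, rfl⟩ := Ideal.Quotient.mk_surjective v
      exact hmv ((hc m p).2 hbox)
  refine hVS.trans ?_
  have hlead : ∀ x ∈ S, ∃ w ∈ mulSpan (gradedPiece b 1) V, c (τ (g x)) w ≠ 0 ∧
      ∀ m : Fin n →₀ ℕ, (∀ i, m i < a i) → toLex (τ (g x)) < toLex m → c m w = 0 := by
    intro x hx
    obtain ⟨hxl, v, hv, hxv, hlt⟩ := Finset.mem_filter.1 hx
    obtain ⟨hgbox, i, hi⟩ := hg x hxl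
    have hτ : τ (g x) = Finsupp.single i 1 + τ x := by
      ext k
      rw [τ_apply, hi]
      simp [τ_apply, Finsupp.single_apply, Pi.single_apply, add_comm, eq_comm]
    obtain ⟨p, rfl⟩ := Ideal.Quotient.mk_surjective v
    refine ⟨Ideal.Quotient.mk b (X i) * Ideal.Quotient.mk b p, Submodule.subset_span
      ⟨_, ⟨X i, (mem_homogeneousSubmodule _ _).2 (isHomogeneous_X K i), rfl⟩, _, hv, rfl⟩, ?_, ?_⟩
    · rw [← map_mul, c_box _ hgbox, hτ, coeff_X_mul, ← c_box _ (mem_boxLevel.1 hxl).1]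
      exact hxv
    · intro m hm hgm
      rw [← map_mul, c_box m hm, coeff_X_mul']
      split_ifs with him
      · have hle : Finsupp.single i 1 ≤ m := by
          rw [Finsupp.single_le_iff]
          exact Nat.one_le_iff_ne_zero.2 (Finsupp.mem_support_iff.1 him)
        have hbox : ∀ k, (m - Finsupp.single i 1 : Fin n →₀ ℕ) k < a k := fun k =>
          lt_of_le_of_lt (Nat.sub_le _ _) (hm k)
        rw [← c_box _ hbox]
        refine hlt _ ?_
        rw [hτ, ← add_tsub_cancel_of_le hle, toLex_add, toLex_add] at hgm
        exact lt_of_add_lt_add_left hgm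
      · rfl
  choose! w hwmem hwne hwlt using hlead
  have hSl : ∀ x ∈ S, x ∈ boxLevel a j := fun x hx => (Finset.mem_filter.1 hx).1
  exact Submodule.card_le_finrank_of_triangular _ S w (fun x => c (τ (g x)))
    (fun x => toLex (τ (g x)))
    (fun x hx y hy h => g_inj (hSl x hx) (hSl y hy) (τ_inj (toLex.injective h))) hwmem hwne
    fun x hx y hy h => hwlt x hx _ (hg y (hSl y hy)).1 h
end

section
/- Let (A, m) be an Artinian Gorenstein local ring with Dilworth number d(A). If a and b are ideals of A with μ(a) = μ(b) = d(A), then μ(a + b) = d(A) and μ(a ∩ b) = d(A); that is, the family F(A) = {a : μ(a) = d(A)} is a lattice under sum and intersection. -/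
open scoped Classical in
/-- `dim_{A/m} (a/b)`: the dimension over the residue field `A/m` of the subquotient `a/b`
(realized as the image of the ideal `a` in `A/b`), for ideals `b ⊆ a` with `m·a ⊆ b`; junk
value `0` if `a/b` is not killed by `m`. -/
noncomputable def resQuotDim {A : Type*} [CommRing A] (m a b : Ideal A) : ℕ :=
  if h : Module.IsTorsionBySet A
      ↥(Submodule.restrictScalars A (a.map (Ideal.Quotient.mk b))) (m : Set A) then
    letI := h.module
    Module.finrank (A ⧸ m) ↥(Submodule.restrictScalars A (a.map (Ideal.Quotient.mk b)))
  else 0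

/-- `μ(a) = dim_{A/m} a/ma`, the minimal number of generators of the ideal `a`. -/
noncomputable def muL {A : Type*} [CommRing A] (m a : Ideal A) : ℕ :=
  resQuotDim m a (m * a)

/-- `τ(a) = dim_{A/m} (a :_A m)/a`, the type of the ideal `a`. -/
noncomputable def tauL {A : Type*} [CommRing A] (m a : Ideal A) : ℕ :=
  resQuotDim m (a.colon m) a

theorem Submodule.length_sup_add_length_inf {R M : Type*} [Ring R] [AddCommGroup M] [Module R M]
    (N P : Submodule R M) :
    Module.length R ↥(N ⊔ P) + Module.length R ↥(N ⊓ P) =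
      Module.length R N + Module.length R P := by
  let f : ↥(N ⊓ P) →ₗ[R] N × P :=
    (Submodule.inclusion inf_le_left).prod (-Submodule.inclusion inf_le_right)
  let g : N × P →ₗ[R] ↥(N ⊔ P) :=
    (Submodule.inclusion le_sup_left).coprod (Submodule.inclusion le_sup_right)
  rw [← Module.length_prod R N P, add_comm]
  refine (Module.length_eq_add_of_exact f g ?_ ?_ ?_).symm
  · intro x y h
    exact Subtype.ext (congrArg (fun z => (z.1 : M)) h)
  · rintro ⟨z, hz⟩
    obtain ⟨x, hx, y, hy, rfl⟩ := Submodule.mem_sup.mp hz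
    exact ⟨(⟨x, hx⟩, ⟨y, hy⟩), rfl⟩
  · rintro ⟨⟨x, hx⟩, ⟨y, hy⟩⟩
    constructor
    · intro h
      have hxy : x + y = 0 := congrArg Subtype.val h
      have hyx : -x = y := neg_eq_of_add_eq_zero_right hxy
      refine ⟨⟨x, hx, ?_⟩, ?_⟩
      · rw [eq_neg_of_add_eq_zero_left hxy]
        exact P.neg_mem hy
      · exact Prod.ext rfl (Subtype.ext hyx)
    · rintro ⟨z, hz⟩
      have h₁ : (z : M) = x := congrArg (fun w => (w.1 : M)) hz
      have h₂ : -(z : M) = y := congrArg (fun w => (w.2 : M)) hz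
      refine Subtype.ext ?_
      change x + y = 0
      rw [← h₁, ← h₂, add_neg_cancel]

theorem Ideal.length_eq_length_add_length_map_quotient {A : Type*} [CommRing A] {a b : Ideal A}
    (hba : b ≤ a) :
    Module.length A a = Module.length A b +
      Module.length A ↥(Submodule.restrictScalars A (a.map (Ideal.Quotient.mk b))) := by
  have hmem (x : a) : b.mkQ x ∈ Submodule.restrictScalars A (a.map (Ideal.Quotient.mk b)) :=
    Ideal.mem_map_of_mem (Ideal.Quotient.mk b) x.2
  let g := (b.mkQ ∘ₗ a.subtype).codRestrict
    (Submodule.restrictScalars A (a.map (Ideal.Quotient.mk b))) hmem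
  refine Module.length_eq_add_of_exact (Submodule.inclusion hba) g
    (Submodule.inclusion_injective hba) ?_ ?_
  · rintro ⟨z, hz⟩
    obtain ⟨x, hx, rfl⟩ :=
      (Ideal.mem_map_iff_of_surjective _ Ideal.Quotient.mk_surjective).mp hz
    exact ⟨⟨x, hx⟩, rfl⟩
  · intro x
    constructor
    · intro h
      have h₀ : Ideal.Quotient.mk b (x : A) = 0 := congrArg Subtype.val h
      exact ⟨⟨x, Ideal.Quotient.eq_zero_iff_mem.mp h₀⟩, rfl⟩
    · rintro ⟨y, rfl⟩
      exact Subtype.ext (Ideal.Quotient.eq_zero_iff_mem.mpr y.2)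

theorem resQuotDim_eq_length {A : Type*} [CommRing A] [IsNoetherianRing A] (m : Ideal A)
    [m.IsMaximal] {a b : Ideal A} (hmab : m * a ≤ b) :
    (resQuotDim m a b : ℕ∞) =
      Module.length A ↥(Submodule.restrictScalars A (a.map (Ideal.Quotient.mk b))) := by
  have h : Module.IsTorsionBySet A
      ↥(Submodule.restrictScalars A (a.map (Ideal.Quotient.mk b))) (m : Set A) := by
    rintro ⟨z, hz⟩ ⟨r, hr⟩
    obtain ⟨x, hx, rfl⟩ :=
      (Ideal.mem_map_iff_of_surjective _ Ideal.Quotient.mk_surjective).mp hz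
    exact Subtype.ext (Ideal.Quotient.eq_zero_iff_mem.mpr (hmab (Ideal.mul_mem_mul hr hx)))
  rw [resQuotDim, dif_pos h]
  let := h.module
  let := Ideal.Quotient.field m
  have : IsScalarTower A (A ⧸ m)
    ↥(Submodule.restrictScalars A (a.map (Ideal.Quotient.mk b))) := h.isScalarTower
  have : Module.Finite (A ⧸ m)
      ↥(Submodule.restrictScalars A (a.map (Ideal.Quotient.mk b))) :=
    Module.Finite.of_restrictScalars_finite A _ _
  rw [Module.length_eq_of_surjective (R := A ⧸ m) Ideal.Quotient.mk_surjective]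
  exact (Module.length_eq_finrank (A ⧸ m) _).symm

theorem length_mul_add_muL {A : Type*} [CommRing A] [IsNoetherianRing A] (m : Ideal A)
    [m.IsMaximal] (a : Ideal A) :
    Module.length A ↥(m * a) + muL m a = Module.length A a := by
  rw [muL, resQuotDim_eq_length m le_rfl,
    ← Ideal.length_eq_length_add_length_map_quotient Ideal.mul_le_right]

theorem muL_add_muL_le {A : Type*} [CommRing A] [IsArtinianRing A] (m : Ideal A) [m.IsMaximal]
    (a b : Ideal A) : muL m a + muL m b ≤ muL m (a ⊔ b) + muL m (a ⊓ b) := by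
  have hlen (c : Ideal A) : ∃ n : ℕ, Module.length A c = n :=
    ⟨_, (ENat.natCast_toNat Module.length_ne_top).symm⟩
  have hinf : Module.length A ↥(m * (a ⊓ b)) ≤ Module.length A ↥(m * a ⊓ m * b) :=
    Module.length_le_of_injective (Submodule.inclusion (le_inf (Ideal.mul_mono_right inf_le_left)
      (Ideal.mul_mono_right inf_le_right))) (Submodule.inclusion_injective _)
  have h₁ := Submodule.length_sup_add_length_inf a b
  have h₂ := Submodule.length_sup_add_length_inf (m * a) (m * b)
  rw [← Ideal.mul_sup] at h₂
  have ha := length_mul_add_muL m a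
  have hb := length_mul_add_muL m b
  have hs := length_mul_add_muL m (a ⊔ b)
  have hi := length_mul_add_muL m (a ⊓ b)
  obtain ⟨la, hla⟩ := hlen a
  obtain ⟨lb, hlb⟩ := hlen b
  obtain ⟨ls, hls⟩ := hlen (a ⊔ b)
  obtain ⟨li, hli⟩ := hlen (a ⊓ b)
  obtain ⟨lma, hlma⟩ := hlen (m * a)
  obtain ⟨lmb, hlmb⟩ := hlen (m * b)
  obtain ⟨lms, hlms⟩ := hlen (m * (a ⊔ b))
  obtain ⟨lmi, hlmi⟩ := hlen (m * (a ⊓ b))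
  obtain ⟨lim, hlim⟩ := hlen (m * a ⊓ m * b)
  rw [hla, hlb, hls, hli] at h₁
  rw [hlma, hlmb, hlms, hlim] at h₂
  rw [hlmi, hlim] at hinf
  rw [hla, hlma] at ha
  rw [hlb, hlmb] at hb
  rw [hls, hlms] at hs
  rw [hli, hlmi] at hi
  norm_cast at *
  omega


/-- **(Ikeda–Watanabe.)**  Let `(A, m)` be an Artinian Gorenstein local ring (i.e.
`dim_{A/m} (0 :_A m) = 1`) with Dilworth number `d(A) = max{μ(a)}`.  If `μ(a) = μ(b) = d(A)`
then `μ(a + b) = d(A)` and `μ(a ∩ b) = d(A)`: the family `F(A) = {a : μ(a) = d(A)}` is a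
lattice under sum and intersection. -/
theorem mu_sup_and_inf_of_mu_eq_dilworth
    {A : Type*} [CommRing A] [IsArtinianRing A] [IsLocalRing A]
    (m : Ideal A) (hm : m = IsLocalRing.maximalIdeal A)
    (hGor : tauL m (⊥ : Ideal A) = 1)
    (d : ℕ) (hd : IsGreatest {e : ℕ | ∃ a : Ideal A, muL m a = e} d)
    (a b : Ideal A) (ha : muL m a = d) (hb : muL m b = d) :
    muL m (a + b) = d ∧ muL m (a ⊓ b) = d := by
  subst hm
  have h := muL_add_muL_le (IsLocalRing.maximalIdeal A) a b
  have hs := hd.2 ⟨a ⊔ b, rfl⟩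
  have hi := hd.2 ⟨a ⊓ b, rfl⟩
  rw [Submodule.add_eq_sup]
  omega
end

section
/- Let (A, m) be an Artinian Gorenstein local ring with Dilworth number d(A). If a is an ideal of A with μ(a) = d(A), then the annihilator 0 :_A a satisfies τ(0 :_A a) = d(A); and if b is an ideal of A with τ(b) = d(A), then μ(0 :_A b) = d(A). Thus a ↦ 0 :_A a gives an inclusion-reversing bijection between F(A) = {a : μ(a) = d(A)} and G(A) = {b : τ(b) = d(A)}, with inverse given by the same formula b ↦ 0 :_A b. -/
section ColonIdeal

variable {A : Type*} [CommRing A]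

theorem mul_eq_zero_of_mem_bot_colon {I : Ideal A} {x y : A}
    (hy : y ∈ (⊥ : Ideal A).colon (I : Set A)) (hx : x ∈ I) : y * x = 0 := by
  simpa using Submodule.mem_colon.mp hy x hx

theorem bot_colon_anti {I J : Ideal A} (h : I ≤ J) :
    (⊥ : Ideal A).colon (J : Set A) ≤ (⊥ : Ideal A).colon (I : Set A) :=
  Submodule.colon_mono le_rfl h

theorem le_bot_colon_bot_colon (I : Ideal A) :
    I ≤ (⊥ : Ideal A).colon ((⊥ : Ideal A).colon (I : Set A) : Set A) := fun x hx ↦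
  Submodule.mem_colon.mpr fun y hy ↦ by
    simpa [mul_comm] using mul_eq_zero_of_mem_bot_colon hy hx

theorem bot_colon_colon (I J : Ideal A) :
    ((⊥ : Ideal A).colon (I : Set A)).colon (J : Set A) =
      (⊥ : Ideal A).colon ((J * I : Ideal A) : Set A) := by
  ext r
  simp only [Submodule.mem_colon, SetLike.mem_coe, smul_eq_mul, Submodule.mem_bot]
  refine ⟨fun h s hs ↦ ?_, fun h j hj i hi ↦ ?_⟩
  · refine Submodule.mul_induction_on hs (fun j hj i hi ↦ ?_) fun x y hx hy ↦ ?_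
    · rw [← mul_assoc]
      exact h j hj i hi
    · rw [mul_add, hx, hy, add_zero]
  · rw [mul_assoc]
    exact h _ (Ideal.mul_mem_mul hj hi)

end ColonIdeal

section Length

variable {R M N : Type*} [Ring R] [AddCommGroup M] [Module R M] [AddCommGroup N] [Module R N]

theorem Submodule.length_eq_length_map_add_length_inf_ker (f : M →ₗ[R] N) (S : Submodule R M) :
    Module.length R S = Module.length R (S.map f) +
      Module.length R (S ⊓ LinearMap.ker f : Submodule R M) := by
  rw [add_comm]
  refine Module.length_eq_add_of_exact (Submodule.inclusion inf_le_left)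
    (f.submoduleMap S) (Submodule.inclusion_injective _) (f.submoduleMap_surjective S) ?_
  intro x
  constructor
  · intro hx
    exact ⟨⟨x, x.2, by simpa using congrArg Subtype.val hx⟩, rfl⟩
  · rintro ⟨y, rfl⟩
    exact Subtype.ext y.2.2

theorem Submodule.length_mono {S T : Submodule R M} (h : S ≤ T) :
    Module.length R S ≤ Module.length R T :=
  Module.length_le_of_injective (Submodule.inclusion h) (Submodule.inclusion_injective h)

theorem Submodule.eq_of_le_of_length_le [IsArtinian R M] [IsNoetherian R M] {S T : Submodule R M}
    (h : S ≤ T) (hl : Module.length R T ≤ Module.length R S) : S = T := by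
  by_contra hne
  have := Submodule.height_strictMono (lt_of_le_of_ne h hne)
  rw [← Module.length_submodule, ← Module.length_submodule] at this
  exact absurd hl this.not_ge

end Length

section SubquotientLength

variable {A : Type*} [CommRing A]

theorem resQuotDim_add_length [IsArtinianRing A] (m : Ideal A) [m.IsMaximal] {a b : Ideal A}
    (hba : b ≤ a) (hab : m * a ≤ b) :
    Module.length A a = resQuotDim m a b + Module.length A b := by
  have hmap : Submodule.restrictScalars A (a.map (Ideal.Quotient.mk b)) =
      Submodule.map (Submodule.mkQ b) a := by
    ext x
    rw [Submodule.restrictScalars_mem,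
      Ideal.mem_map_iff_of_surjective _ Ideal.Quotient.mk_surjective]
    rfl
  have htors : Module.IsTorsionBySet A
      ↥(Submodule.restrictScalars A (a.map (Ideal.Quotient.mk b))) (m : Set A) := by
    rintro ⟨x, hx⟩ ⟨r, hr⟩
    rw [hmap] at hx
    obtain ⟨y, hy, rfl⟩ := hx
    refine Subtype.ext ?_
    change r • Submodule.mkQ b y = 0
    rw [← map_smul, Submodule.mkQ_apply, Submodule.Quotient.mk_eq_zero]
    exact hab (Ideal.mul_mem_mul hr hy)
  have hlen := Submodule.length_eq_length_map_add_length_inf_ker (Submodule.mkQ b) a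
  rw [Submodule.ker_mkQ, inf_eq_right.mpr hba, ← hmap] at hlen
  rw [hlen, resQuotDim, dif_pos htors]
  congr 1
  let := htors.module
  let := Ideal.Quotient.field m
  have : IsScalarTower A (A ⧸ m) ↥(Submodule.restrictScalars A (a.map (Ideal.Quotient.mk b))) :=
    htors.isScalarTower
  have : Module.Finite (A ⧸ m)
      ↥(Submodule.restrictScalars A (a.map (Ideal.Quotient.mk b))) :=
    Module.Finite.of_restrictScalars_finite A _ _
  rw [Module.length_eq_of_surjective (R := A ⧸ m) Ideal.Quotient.mk_surjective]
  exact Module.length_eq_finrank (A ⧸ m) _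

theorem muL_add_length [IsArtinianRing A] (m : Ideal A) [m.IsMaximal] (a : Ideal A) :
    Module.length A a = muL m a + Module.length A (m * a : Ideal A) :=
  resQuotDim_add_length m Ideal.mul_le_right le_rfl

theorem tauL_add_length [IsArtinianRing A] (m : Ideal A) [m.IsMaximal] (a : Ideal A) :
    Module.length A (a.colon (m : Set A)) = tauL m a + Module.length A a :=
  resQuotDim_add_length m Ideal.le_colon <| Ideal.mul_le.mpr fun r hr s hs ↦ by
    simpa [mul_comm] using Submodule.mem_colon.mp hs r hr

end SubquotientLength

section GorensteinDuality

variable {A : Type*} [CommRing A] [IsLocalRing A]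

open IsLocalRing

theorem mul_mem_of_covBy {I J : Ideal A} (h : J ⋖ I) {r x : A} (hr : r ∈ maximalIdeal A)
    (hx : x ∈ I) : r * x ∈ J := by
  by_contra hrx
  have hle : J ⊔ Ideal.span {r * x} ≤ I :=
    sup_le h.le ((Ideal.span_singleton_le_iff_mem I).mpr (I.mul_mem_left r hx))
  have hlt : J < J ⊔ Ideal.span {r * x} :=
    left_lt_sup.mpr fun hc ↦ hrx (hc (Ideal.mem_span_singleton_self _))
  rw [← eq_of_le_of_not_lt hle (h.2 hlt)] at hx
  obtain ⟨j, hj, z, hz, hjz⟩ := Submodule.mem_sup.mp hx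
  obtain ⟨c, rfl⟩ := Ideal.mem_span_singleton'.mp hz
  have hunit : IsUnit (1 - c * r) :=
    isUnit_one_sub_self_of_mem_nonunits _ ((maximalIdeal A).mul_mem_left c hr)
  have hmem : (1 - c * r) * x ∈ J := by
    have : (1 - c * r) * x = j := by linear_combination -hjz
    rwa [this]
  exact hrx (J.mul_mem_left r ((Ideal.unit_mul_mem_iff_mem J hunit).mp hmem))

theorem length_bot_colon_le_of_covBy
    (hsocle : Module.length A ((⊥ : Ideal A).colon (maximalIdeal A : Set A)) = 1)
    {I J : Ideal A} (h : J ⋖ I) :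
    Module.length A ((⊥ : Ideal A).colon (J : Set A)) ≤
      1 + Module.length A ((⊥ : Ideal A).colon (I : Set A)) := by
  obtain ⟨x, hxI, hxJ⟩ := SetLike.exists_of_lt h.lt
  have hI : J ⊔ Ideal.span {x} = I := eq_of_le_of_not_lt
    (sup_le h.le ((Ideal.span_singleton_le_iff_mem I).mpr hxI))
    (h.2 (left_lt_sup.mpr fun hc ↦ hxJ (hc (Ideal.mem_span_singleton_self x))))
  rw [Submodule.length_eq_length_map_add_length_inf_ker (LinearMap.mulRight A x)]
  refine add_le_add (hsocle ▸ Submodule.length_mono ?_) (Submodule.length_mono ?_)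
  · rintro _ ⟨y, hy, rfl⟩
    refine Submodule.mem_colon.mpr fun r hr ↦ ?_
    have := mul_eq_zero_of_mem_bot_colon hy (mul_mem_of_covBy h hr hxI)
    simp only [LinearMap.mulRight_apply, smul_eq_mul, Submodule.mem_bot]
    rw [mul_assoc, mul_comm x r, this]
  · rintro y ⟨hy, hyx⟩
    refine Submodule.mem_colon.mpr fun s hs ↦ ?_
    rw [← hI] at hs
    obtain ⟨j, hj, z, hz, rfl⟩ := Submodule.mem_sup.mp hs
    obtain ⟨c, rfl⟩ := Ideal.mem_span_singleton'.mp hz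
    have hyx : y * x = 0 := hyx
    rw [Submodule.mem_bot, smul_eq_mul, mul_add, mul_eq_zero_of_mem_bot_colon hy hj,
      mul_left_comm, hyx, mul_zero, add_zero]

variable [IsArtinianRing A]

theorem length_bot_colon_add_length_le_of_covBy
    (hsocle : Module.length A ((⊥ : Ideal A).colon (maximalIdeal A : Set A)) = 1)
    {I J : Ideal A} (h : J ⋖ I) :
    Module.length A ((⊥ : Ideal A).colon (J : Set A)) + Module.length A J ≤
      Module.length A ((⊥ : Ideal A).colon (I : Set A)) + Module.length A I := by
  have hlt : Module.length A J < Module.length A I := by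
    simpa only [Module.length_submodule] using Submodule.height_strictMono h.lt
  calc _ ≤ 1 + Module.length A ((⊥ : Ideal A).colon (I : Set A)) + Module.length A J :=
        add_le_add_left (length_bot_colon_le_of_covBy hsocle h) _
    _ = Module.length A ((⊥ : Ideal A).colon (I : Set A)) + (Module.length A J + 1) := by ring
    _ ≤ _ := add_le_add_right (Order.add_one_le_of_lt hlt) _

theorem length_bot_colon_add_length
    (hsocle : Module.length A ((⊥ : Ideal A).colon (maximalIdeal A : Set A)) = 1)
    (I : Ideal A) :
    Module.length A ((⊥ : Ideal A).colon (I : Set A)) + Module.length A I =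
      Module.length A A := by
  apply le_antisymm
  · induction I using WellFoundedGT.induction with
    | ind I ih =>
      rcases eq_or_lt_of_le (le_top : I ≤ ⊤) with rfl | hI
      · have : (⊥ : Ideal A).colon ((⊤ : Ideal A) : Set A) = ⊥ := by
          rw [Submodule.top_coe, Submodule.colon_univ]
        rw [this]
        simp
      · obtain ⟨K, hK, -⟩ := exists_covBy_le_of_lt hI
        exact (length_bot_colon_add_length_le_of_covBy hsocle hK).trans (ih K hK.lt)
  · induction I using WellFoundedLT.induction with
    | ind I ih =>
      rcases eq_or_lt_of_le (bot_le : ⊥ ≤ I) with rfl | hI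
      · rw [Submodule.colon_bot]
        simp
      · obtain ⟨K, -, hK⟩ := exists_le_covBy_of_lt hI
        exact (ih K hK.lt).trans (length_bot_colon_add_length_le_of_covBy hsocle hK)

theorem bot_colon_bot_colon
    (hsocle : Module.length A ((⊥ : Ideal A).colon (maximalIdeal A : Set A)) = 1)
    (I : Ideal A) :
    (⊥ : Ideal A).colon ((⊥ : Ideal A).colon (I : Set A) : Set A) = I := by
  refine (Submodule.eq_of_le_of_length_le (le_bot_colon_bot_colon I) ?_).symm
  have h₁ := length_bot_colon_add_length hsocle I
  have h₂ := length_bot_colon_add_length hsocle ((⊥ : Ideal A).colon (I : Set A))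
  rw [← h₁, add_comm] at h₂
  exact (WithTop.add_left_cancel Module.length_ne_top h₂).le

theorem tauL_bot_colon
    (hsocle : Module.length A ((⊥ : Ideal A).colon (maximalIdeal A : Set A)) = 1)
    (I : Ideal A) :
    tauL (maximalIdeal A) ((⊥ : Ideal A).colon (I : Set A)) = muL (maximalIdeal A) I := by
  have h₁ := length_bot_colon_add_length hsocle I
  have h₂ := length_bot_colon_add_length hsocle (maximalIdeal A * I)
  have hτ := tauL_add_length (maximalIdeal A) ((⊥ : Ideal A).colon (I : Set A))
  have hμ := muL_add_length (maximalIdeal A) I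
  rw [bot_colon_colon] at hτ
  rw [hτ, ← h₁, hμ] at h₂
  have ha : Module.length A ((⊥ : Ideal A).colon (I : Set A)) ≠ ⊤ := Module.length_ne_top
  have hb : Module.length A (maximalIdeal A * I : Ideal A) ≠ ⊤ := Module.length_ne_top
  generalize Module.length A ((⊥ : Ideal A).colon (I : Set A)) = p at h₂ ha
  generalize Module.length A (maximalIdeal A * I : Ideal A) = q at h₂ hb
  lift p to ℕ using ha
  lift q to ℕ using hb
  norm_cast at h₂
  omega

end GorensteinDuality

/-- **(Ikeda–Watanabe.)**  Let `(A, m)` be an Artinian Gorenstein local ring (i.e.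
`dim_{A/m} (0 :_A m) = 1`) with Dilworth number `d(A) = max{μ(a)}`.  Then `a ↦ 0 :_A a`
carries `F(A) = {a : μ(a) = d(A)}` into `G(A) = {b : τ(b) = d(A)}` and vice versa; being
inclusion-reversing and an involution (by Gorenstein duality), it is an inclusion-reversing
bijection between `F(A)` and `G(A)` whose inverse is given by the same formula. -/
theorem annihilator_bijection_dilworth
    {A : Type*} [CommRing A] [IsArtinianRing A] [IsLocalRing A]
    (m : Ideal A) (hm : m = IsLocalRing.maximalIdeal A)
    (hGor : tauL m (⊥ : Ideal A) = 1)
    (d : ℕ) (hd : IsGreatest {e : ℕ | ∃ a : Ideal A, muL m a = e} d) :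
    (∀ a : Ideal A, muL m a = d →
        tauL m ((⊥ : Ideal A).colon a) = d ∧ (⊥ : Ideal A).colon ((⊥ : Ideal A).colon a) = a) ∧
    (∀ b : Ideal A, tauL m b = d →
        muL m ((⊥ : Ideal A).colon b) = d ∧ (⊥ : Ideal A).colon ((⊥ : Ideal A).colon b) = b) ∧
    (∀ a a' : Ideal A, a ≤ a' → (⊥ : Ideal A).colon a' ≤ (⊥ : Ideal A).colon a) := by
  subst hm
  have hsocle : Module.length A
      ((⊥ : Ideal A).colon (IsLocalRing.maximalIdeal A : Set A)) = 1 := by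
    rw [tauL_add_length, hGor, Module.length_bot]
    simp
  refine ⟨fun a ha ↦ ⟨(tauL_bot_colon hsocle a).trans ha, bot_colon_bot_colon hsocle a⟩,
    fun b hb ↦ ⟨?_, bot_colon_bot_colon hsocle b⟩, fun _ _ h ↦ bot_colon_anti h⟩
  rw [← tauL_bot_colon hsocle, bot_colon_bot_colon hsocle, hb]
end
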